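/- arXiv:1906.09654 — 3 statements merged into one kernel-verified Lean document; each statement's English description precedes it below -/
import Mathlib

section
/- Fix integers k ≥ 2 and p ≥ 1, let (w_{1,n}, …, w_{p,n}) be independent F_k-valued random variables satisfying radial symmetry, positive drift, and subexponential growth, and fix ε > 0. Then with probability going to 1 exponentially fast as n → ∞: for every non-trivial element g of the subgroup H = ⟨w_{1,n}, …, w_{p,n}⟩, the cyclic reduction of g, regarded as a cyclic word, is ε-equidistributed. -/
open MeasureTheory

noncomputable section

/-- Every set of a free group is measurable (discrete σ-algebra). -/
instance freeGroupMeasurableSpace {α : Type*} : MeasurableSpace (FreeGroup α) := ⊤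

/-- The length `|g|` of the reduced word representing `g`. -/
def wlen {k : ℕ} (g : FreeGroup (Fin k)) : ℕ := (FreeGroup.toWord g).length

/-- The inverse of a letter of `X^{±1}` (letters are encoded as `Fin k × Bool`). -/
def invL {k : ℕ} (a : Fin k × Bool) : Fin k × Bool := (a.1, !a.2)

/-- `g` is cyclically reduced: the concatenation of its reduced word with itself is
reduced (equivalently, the last letter is not the inverse of the first). -/
def IsCyclicallyReduced {k : ℕ} (g : FreeGroup (Fin k)) : Prop :=
  FreeGroup.reduce (FreeGroup.toWord g ++ FreeGroup.toWord g) =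
    FreeGroup.toWord g ++ FreeGroup.toWord g

/-- The word `l = s_1 ⋯ s_ℓ`, regarded as a cyclic word, is `ε`-equidistributed:
every letter `u` has frequency within `ε` of `1/(2k)`, and every two-letter word `uv`
with `v ≠ u⁻¹` has cyclic frequency (computed via the pairs `(s_i, s_{i+1 mod ℓ})`,
i.e. `l.zip (l.rotate 1)`) within `ε` of `1/(2k(2k−1))`. -/
def EquiDistributed (k : ℕ) (ε : ℝ) (l : List (Fin k × Bool)) : Prop :=
  (∀ u : Fin k × Bool, |((l.count u : ℝ) / (l.length : ℝ)) - 1 / (2 * k)| ≤ ε) ∧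
  (∀ u v : Fin k × Bool, v ≠ invL u →
    |(((l.zip (l.rotate 1)).count (u, v) : ℝ) / (l.length : ℝ)) -
      1 / (2 * k * (2 * k - 1))| ≤ ε)

/-- A family of "failure probabilities" decays exponentially: the corresponding events
hold with probability going to 1 exponentially fast as `n → ∞`. -/
def ExpDecay (f : ℕ → ENNReal) : Prop :=
  ∃ C : ℝ, 0 < C ∧ ∃ κ : ℝ, 1 < κ ∧ ∀ n : ℕ, f n ≤ ENNReal.ofReal (C / κ ^ n)

section PairSum

variable {β : Type*} (φ : β → β → ℝ)

/-- The sum of `φ a b` over the pairs `(a, b)` of consecutive letters of a word. -/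
def pairSum : List β → ℝ
  | [] => 0
  | [_] => 0
  | a :: b :: l => φ a b + pairSum (b :: l)

theorem pairSum_append_cons (x : List β) (h : β) (y : List β) :
    pairSum φ (x ++ h :: y) = pairSum φ (x ++ [h]) + pairSum φ (h :: y) := by
  induction x with
  | nil => simp [pairSum]
  | cons a x ih =>
    cases x with
    | nil => simp [pairSum]
    | cons b x =>
      simp only [List.cons_append, pairSum] at ih ⊢
      rw [ih, add_assoc]

theorem pairSum_concat (h : β) (t : List β) (x : β) :
    pairSum φ (h :: t ++ [x]) =
      (((h :: t).zip (t ++ [x])).map fun ab => φ ab.1 ab.2).sum := by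
  induction t generalizing h with
  | nil => simp [pairSum]
  | cons b t ih =>
    simp only [List.cons_append, pairSum, List.zip_cons_cons, List.map_cons, List.sum_cons]
      at ih ⊢
    rw [ih]

variable {φ}

theorem abs_pairSum_le (hφ : ∀ a b, |φ a b| ≤ 1) (l : List β) :
    |pairSum φ l| ≤ l.length := by
  induction l with
  | nil => simp [pairSum]
  | cons a l ih =>
    cases l with
    | nil => simp [pairSum]
    | cons b l =>
      have := abs_add_le (φ a b) (pairSum φ (b :: l))
      have := hφ a b
      rw [pairSum, List.length_cons (a := a)]
      push_cast
      linarith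

theorem abs_pairSum_append_sub_le (hφ : ∀ a b, |φ a b| ≤ 1) (x y : List β) :
    |pairSum φ (x ++ y) - pairSum φ x - pairSum φ y| ≤ 1 := by
  induction x with
  | nil => simp [pairSum]
  | cons a x ih =>
    cases x with
    | nil =>
      cases y with
      | nil => simp [pairSum]
      | cons b y => simpa [pairSum] using hφ a b
    | cons b x =>
      simp only [List.cons_append, pairSum] at ih ⊢
      convert ih using 2
      ring

theorem pairSum_flatten_replicate (h : β) (t : List β) (N : ℕ) :
    pairSum φ ((List.replicate N (h :: t)).flatten ++ [h]) =
      N * pairSum φ (h :: t ++ [h]) := by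
  induction N with
  | zero => simp [pairSum]
  | succ N ih =>
    cases N with
    | zero => simp
    | succ N =>
      rw [List.replicate_succ, List.flatten_cons, List.append_assoc]
      rw [List.replicate_succ, List.flatten_cons] at ih ⊢
      simp only [List.cons_append] at ih ⊢
      rw [← List.cons_append, pairSum_append_cons, ih]
      push_cast
      simp only [List.cons_append]
      ring

end PairSum

section Cancellation

theorem abs_pairSum_cancel_le {α : Type*} {φ : α × Bool → α × Bool → ℝ}
    (hφ : ∀ a b, |φ a b| ≤ 1) (x d y : List (α × Bool)) :
    |pairSum φ (x ++ y) - pairSum φ (x ++ d) - pairSum φ (FreeGroup.invRev d ++ y)| ≤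
      2 * d.length + 3 := by
  have h1 := abs_le.1 (abs_pairSum_append_sub_le hφ x y)
  have h2 := abs_le.1 (abs_pairSum_append_sub_le hφ x d)
  have h3 := abs_le.1 (abs_pairSum_append_sub_le hφ (FreeGroup.invRev d) y)
  have h4 := abs_le.1 (abs_pairSum_le hφ d)
  have h5 := abs_le.1 (abs_pairSum_le hφ (FreeGroup.invRev d))
  rw [FreeGroup.invRev_length] at h5
  rw [abs_le]
  constructor <;> linarith [h1.1, h1.2, h2.1, h2.2, h3.1, h3.2, h4.1, h4.2, h5.1, h5.2]

variable {α : Type*} [DecidableEq α]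

/-- The product of two reduced words, with the cancelled part `d` made explicit. -/
theorem FreeGroup.IsReduced.exists_cancel {l₁ l₂ : List (α × Bool)}
    (h₁ : FreeGroup.IsReduced l₁) (h₂ : FreeGroup.IsReduced l₂) :
    ∃ x d y, l₁ = x ++ d ∧ l₂ = FreeGroup.invRev d ++ y ∧
      FreeGroup.reduce (l₁ ++ l₂) = x ++ y := by
  induction l₁ using List.reverseRecOn generalizing l₂ with
  | nil => exact ⟨[], [], l₂, by simp, by simp, by simpa using h₂.reduce_eq⟩
  | append_singleton l a ih =>
    by_cases hr : FreeGroup.IsReduced (l ++ [a] ++ l₂)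
    · exact ⟨l ++ [a], [], l₂, by simp, by simp, hr.reduce_eq⟩
    · cases l₂ with
      | nil => exact absurd (by simpa using h₁) hr
      | cons b l₂ =>
        have hab : b = (a.1, !a.2) := by
          by_contra hne
          apply hr
          refine List.isChain_append.2 ⟨h₁, h₂, ?_⟩
          intro u hu v hv huv
          simp only [List.getLast?_concat, Option.mem_def, Option.some.injEq,
            List.head?_cons] at hu hv
          subst hu hv
          by_contra h2
          exact hne (Prod.ext huv.symm (by cases h : b.2 <;> cases h' : a.2 <;> simp_all))
        obtain ⟨x, d, y, hx, hy, hxy⟩ := ih (h₁.infix ⟨[], [a], by simp⟩)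
          (l₂ := l₂) (h₂.infix ⟨[b], [], by simp⟩)
        refine ⟨x, d ++ [a], y, by simp [hx], ?_, ?_⟩
        · rw [FreeGroup.invRev_append, hab, hy]
          simp [FreeGroup.invRev]
        · rw [← hxy]
          apply FreeGroup.reduce.Step.eq
          rw [hab, List.append_assoc]
          exact FreeGroup.Red.Step.not

theorem FreeGroup.exists_cancel (g h : FreeGroup α) :
    ∃ x d y, g.toWord = x ++ d ∧ h.toWord = FreeGroup.invRev d ++ y ∧
      (g * h).toWord = x ++ y := by
  rw [FreeGroup.toWord_mul]
  exact FreeGroup.isReduced_toWord.exists_cancel FreeGroup.isReduced_toWord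

variable {φ : α × Bool → α × Bool → ℝ}

theorem abs_pairSum_conj_sub_le (hφ : ∀ a b, |φ a b| ≤ 1) (c z : FreeGroup α) :
    |pairSum φ (c * z * c⁻¹).toWord - pairSum φ z.toWord| ≤ 6 * c.toWord.length + 6 := by
  obtain ⟨x, d, y, h1, h2, h3⟩ := FreeGroup.exists_cancel c z
  obtain ⟨x', d', y', h1', h2', h3'⟩ := FreeGroup.exists_cancel (c * z) c⁻¹
  have e := abs_le.1 (abs_pairSum_cancel_le hφ x d y)
  have e' := abs_le.1 (abs_pairSum_cancel_le hφ x' d' y')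
  rw [← h1, ← h2, ← h3] at e
  rw [← h1', ← h2', ← h3'] at e'
  have f := abs_le.1 (abs_pairSum_le hφ c.toWord)
  have f' := abs_le.1 (abs_pairSum_le hφ c⁻¹.toWord)
  have g : (d.length : ℝ) ≤ c.toWord.length := by rw [h1]; simp
  have g' : (d'.length : ℝ) ≤ c.toWord.length := by
    have := congrArg List.length h2'
    rw [FreeGroup.toWord_inv, FreeGroup.invRev_length, List.length_append,
      FreeGroup.invRev_length] at this
    exact_mod_cast this ▸ Nat.le_add_right _ _
  rw [FreeGroup.toWord_inv, FreeGroup.invRev_length] at f'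
  rw [FreeGroup.toWord_inv] at e'
  rw [abs_le]
  constructor <;> linarith [e.1, e.2, e'.1, e'.2, f.1, f.2, f'.1, f'.2]

theorem length_toWord_conj_le (c z : FreeGroup α) :
    (c * z * c⁻¹).toWord.length ≤ z.toWord.length + 2 * c.toWord.length := by
  have h1 := FreeGroup.norm_mul_le (c * z) c⁻¹
  have h2 := FreeGroup.norm_mul_le c z
  rw [FreeGroup.norm_inv_eq] at h1
  simp only [FreeGroup.norm] at h1 h2
  omega

end Cancellation

section Subgroups

variable {α ι : Type*}

/-- The image of a letter of `FreeGroup ι` under the homomorphism sending generators to `w`. -/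
def letterImage (w : ι → FreeGroup α) (a : ι × Bool) : FreeGroup α :=
  cond a.2 (w a.1) (w a.1)⁻¹

theorem letterImage_inv (w : ι → FreeGroup α) (a : ι × Bool) :
    letterImage w (a.1, !a.2) = (letterImage w a)⁻¹ := by
  rcases a with ⟨i, _ | _⟩ <;> simp [letterImage]

variable [DecidableEq α]

variable {φ : α × Bool → α × Bool → ℝ} {w : ι → FreeGroup α} {m : ℕ} {η : ℝ}

theorem exists_bound_prod_letterImage (hφ : ∀ a b, |φ a b| ≤ 1) (hm : 1 ≤ m)
    (hlen : ∀ a, 2 * m ≤ (letterImage w a).toWord.length)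
    (hsum : ∀ a, |pairSum φ (letterImage w a).toWord| + 5 * m ≤
      η * ((letterImage w a).toWord.length - 2 * m))
    (hsep : ∀ a b, a ≠ b →
      (letterImage w a).toWord.take m ≠ (letterImage w b).toWord.take m)
    (a : ι × Bool) (A : List (ι × Bool)) (hA : FreeGroup.IsReduced (a :: A)) :
    ∃ T : ℝ, |pairSum φ ((a :: A).map (letterImage w)).prod.toWord| ≤ η * T ∧
      T ≤ ((a :: A).map (letterImage w)).prod.toWord.length ∧
      ((a :: A).map (letterImage w)).prod.toWord.take m = (letterImage w a).toWord.take m := by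
  induction A generalizing a with
  | nil =>
    refine ⟨(letterImage w a).toWord.length - 2 * m, ?_, ?_, by simp⟩
    · have := hsum a
      simp only [List.map_cons, List.map_nil, List.prod_singleton]
      linarith [(Nat.cast_nonneg m : (0 : ℝ) ≤ m)]
    · simp
  | cons b A ih =>
    obtain ⟨T, hT, hTlen, htake⟩ := ih b (hA.infix ⟨[a], [], by simp⟩)
    rw [List.map_cons, List.prod_cons]
    set h := (List.map (letterImage w) (b :: A)).prod
    obtain ⟨x, d, y, h1, h2, h3⟩ := FreeGroup.exists_cancel (letterImage w a) h
    have hd : d.length < m := by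
      by_contra! hd
      have hd' : m ≤ (FreeGroup.invRev d).length := by simpa using hd
      refine hsep (a.1, !a.2) b ?_ ?_
      · rintro rfl
        have := (List.isChain_cons_cons.1 hA).1 rfl
        simp at this
      · rw [letterImage_inv, FreeGroup.toWord_inv, h1, FreeGroup.invRev_append, ← htake, h2,
          List.take_append_of_le_length hd', List.take_append_of_le_length hd']
    have hxd : (letterImage w a).toWord.length = x.length + d.length := by simp [h1]
    have hdy : h.toWord.length = d.length + y.length := by simp [h2]
    refine ⟨T + ((letterImage w a).toWord.length - 2 * m), ?_, ?_, ?_⟩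
    · have e := abs_le.1 (abs_pairSum_cancel_le hφ x d y)
      rw [← h1, ← h2, ← h3] at e
      have hs := hsum a
      have hs' := abs_le.1 hT
      have hs'' := abs_le.1 (le_refl |pairSum φ (letterImage w a).toWord|)
      have : (d.length : ℝ) ≤ m := by exact_mod_cast hd.le
      have : (1 : ℝ) ≤ m := by exact_mod_cast hm
      rw [abs_le, mul_add]
      constructor <;> linarith [e.1, e.2, hs'.1, hs'.2, hs''.1, hs''.2]
    · rw [h3, List.length_append, hxd]
      rw [hdy] at hTlen
      push_cast at hTlen ⊢
      have : (d.length : ℝ) ≤ m := by exact_mod_cast hd.le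
      linarith
    · have hx : m ≤ x.length := by have := hlen a; omega
      rw [h3, h1, List.take_append_of_le_length hx, List.take_append_of_le_length hx]

/-- If the generators are long, pairwise almost free of cancellation, and have small pair sums,
then so do all elements of the subgroup they generate. -/
theorem abs_pairSum_le_of_mem_closure (hφ : ∀ a b, |φ a b| ≤ 1) (hm : 1 ≤ m) (hη : 0 ≤ η)
    (hlen : ∀ a, 2 * m ≤ (letterImage w a).toWord.length)
    (hsum : ∀ a, |pairSum φ (letterImage w a).toWord| + 5 * m ≤
      η * ((letterImage w a).toWord.length - 2 * m))
    (hsep : ∀ a b, a ≠ b →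
      (letterImage w a).toWord.take m ≠ (letterImage w b).toWord.take m)
    {g : FreeGroup α} (hg : g ∈ Subgroup.closure (Set.range w)) :
    |pairSum φ g.toWord| ≤ η * g.toWord.length := by
  classical
  rw [← FreeGroup.range_lift_eq_closure] at hg
  obtain ⟨γ, rfl⟩ := hg
  have hγ : FreeGroup.lift w γ = (γ.toWord.map (letterImage w)).prod := by
    conv_lhs => rw [← FreeGroup.mk_toWord (x := γ), FreeGroup.lift_mk]
    rfl
  rw [hγ]
  have hred : FreeGroup.IsReduced γ.toWord := FreeGroup.isReduced_toWord
  cases hA : γ.toWord with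
  | nil => simp [pairSum]
  | cons a A =>
    rw [hA] at hred
    obtain ⟨T, h1, h2, -⟩ := exists_bound_prod_letterImage hφ hm hlen hsum hsep a A hred
    exact h1.trans (by gcongr)

end Subgroups

section CyclicSum

variable {k : ℕ}

theorem toWord_pow_of_isCyclicallyReduced {r : FreeGroup (Fin k)} (hr : IsCyclicallyReduced r)
    (N : ℕ) : (r ^ N).toWord = (List.replicate N r.toWord).flatten := by
  have h : FreeGroup.IsReduced (r.toWord ++ r.toWord) := FreeGroup.isReduced_iff_reduce_eq.2 hr
  have h' : FreeGroup.IsCyclicallyReduced r.toWord :=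
    ⟨FreeGroup.isReduced_toWord, (List.isChain_append.1 h).2.2⟩
  rw [FreeGroup.toWord_pow, (h'.flatten_replicate N).isReduced.reduce_eq]

theorem le_of_forall_nat_mul_le {x y K : ℝ} (h : ∀ N : ℕ, N * x ≤ N * y + K) : x ≤ y := by
  by_contra! hxy
  obtain ⟨N, hN⟩ := exists_nat_gt (K / (x - y))
  rw [div_lt_iff₀ (by linarith)] at hN
  linarith [h N]

/-- A linear bound on pair sums over a subgroup passes to cyclic reductions. -/
theorem abs_cyclic_pairSum_le {φ : Fin k × Bool → Fin k × Bool → ℝ} (hφ : ∀ a b, |φ a b| ≤ 1)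
    {η : ℝ} (hη : 0 ≤ η) {H : Subgroup (FreeGroup (Fin k))}
    (hH : ∀ g ∈ H, |pairSum φ g.toWord| ≤ η * g.toWord.length)
    {c r : FreeGroup (Fin k)} (hcr : c * r * c⁻¹ ∈ H) (hr : IsCyclicallyReduced r)
    {h : Fin k × Bool} {t : List (Fin k × Bool)} (hht : r.toWord = h :: t) :
    |pairSum φ (h :: t ++ [h])| ≤ η * r.toWord.length := by
  refine le_of_forall_nat_mul_le
    (K := η * (2 * c.toWord.length) + (6 * c.toWord.length + 6) + 1) fun N => ?_
  have hmem : c * r ^ N * c⁻¹ ∈ H := by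
    rw [← conj_pow]
    exact H.pow_mem hcr N
  have h1 := hH _ hmem
  have h2 := abs_pairSum_conj_sub_le hφ c (r ^ N)
  have h3 : ((c * r ^ N * c⁻¹).toWord.length : ℝ) ≤
      N * r.toWord.length + 2 * c.toWord.length := by
    have := length_toWord_conj_le c (r ^ N)
    rw [toWord_pow_of_isCyclicallyReduced hr] at this
    simp only [List.length_flatten, List.map_replicate, List.sum_replicate, smul_eq_mul] at this
    exact_mod_cast this
  have h4 := abs_pairSum_append_sub_le hφ (r ^ N).toWord [h]
  have h5 : pairSum φ ((r ^ N).toWord ++ [h]) = N * pairSum φ (h :: t ++ [h]) := by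
    rw [toWord_pow_of_isCyclicallyReduced hr, hht, pairSum_flatten_replicate]
  rw [h5] at h4
  simp only [pairSum, sub_zero] at h4
  have h6 : (N : ℝ) * |pairSum φ (h :: t ++ [h])| = |N * pairSum φ (h :: t ++ [h])| := by
    rw [abs_mul, Nat.abs_cast]
  have h7 := mul_le_mul_of_nonneg_left h3 hη
  have h4' := abs_le.1 h4
  have h2' := abs_le.1 h2
  have h1' := abs_le.1 h1
  rw [h6, abs_le]
  constructor <;> linarith [h4'.1, h4'.2, h2'.1, h2'.2, h1'.1, h1'.2]

/-- The centred indicator of the event that the first letter of a pair is `u`. -/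
def letterDev (k : ℕ) (u a _b : Fin k × Bool) : ℝ :=
  (if a = u then 1 else 0) - 1 / (2 * k)

/-- The centred indicator of the pair `(u, v)`. -/
def pairDev (k : ℕ) (u v a b : Fin k × Bool) : ℝ :=
  (if (a, b) = (u, v) then 1 else 0) - 1 / (2 * k * (2 * k - 1))

theorem sum_map_ite_sub {β : Type*} [DecidableEq β] [BEq β] [LawfulBEq β] (x : β)
    (s : ℝ) (l : List β) :
    (l.map fun a => (if a = x then (1 : ℝ) else 0) - s).sum = l.count x - l.length * s := by
  induction l with
  | nil => simp
  | cons a l ih =>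
    simp only [List.map_cons, List.sum_cons, ih, List.count_cons, List.length_cons, beq_iff_eq]
    split_ifs <;> push_cast <;> ring

theorem pairSum_letterDev (u h : Fin k × Bool) (t : List (Fin k × Bool)) :
    pairSum (letterDev k u) (h :: t ++ [h]) =
      (h :: t).count u - (h :: t).length * (1 / (2 * k)) := by
  rw [pairSum_concat, ← sum_map_ite_sub]
  simp only [letterDev]
  congr 1
  conv_rhs => rw [← List.map_fst_zip (l₁ := h :: t) (l₂ := t ++ [h]) (by simp), List.map_map]
  rfl

theorem pairSum_pairDev (u v h : Fin k × Bool) (t : List (Fin k × Bool)) :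
    pairSum (pairDev k u v) (h :: t ++ [h]) =
      ((h :: t).zip ((h :: t).rotate 1)).count (u, v) -
        (h :: t).length * (1 / (2 * k * (2 * k - 1))) := by
  have hlen : ((h :: t).zip ((h :: t).rotate 1)).length = (h :: t).length := by simp
  rw [pairSum_concat, ← hlen, ← sum_map_ite_sub]
  simp [pairDev]

theorem equiDistributed_of_abs_pairSum_le {ε : ℝ} {h : Fin k × Bool} {t : List (Fin k × Bool)}
    (h₁ : ∀ u, |pairSum (letterDev k u) (h :: t ++ [h])| ≤ ε * (h :: t).length)
    (h₂ : ∀ u v, v ≠ invL u →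
      |pairSum (pairDev k u v) (h :: t ++ [h])| ≤ ε * (h :: t).length) :
    EquiDistributed k ε (h :: t) := by
  have hpos : (0 : ℝ) < (h :: t).length := by
    rw [List.length_cons]
    positivity
  have key (x s : ℝ) (hx : |x - (h :: t).length * s| ≤ ε * (h :: t).length) :
      |x / (h :: t).length - s| ≤ ε := by
    rw [show x / ((h :: t).length : ℝ) - s = (x - (h :: t).length * s) / (h :: t).length by
      field_simp, abs_div, abs_of_pos hpos, div_le_iff₀ hpos]
    exact hx
  refine ⟨fun u => key _ _ ?_, fun u v huv => key _ _ ?_⟩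
  · rw [← pairSum_letterDev]; exact h₁ u
  · rw [← pairSum_pairDev]; exact h₂ u v huv

end CyclicSum

section Counting

variable {k : ℕ}

theorem invL_involutive : Function.Involutive (invL (k := k)) := fun a => by simp [invL]

theorem isReduced_cons_cons_iff {a b : Fin k × Bool} {l : List (Fin k × Bool)} :
    FreeGroup.IsReduced (a :: b :: l) ↔ a ≠ invL b ∧ FreeGroup.IsReduced (b :: l) := by
  rw [FreeGroup.IsReduced, List.isChain_cons_cons]
  refine and_congr_left fun _ => ?_
  rcases a with ⟨i, s⟩
  rcases b with ⟨j, t⟩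
  simp only [invL, ne_eq, Prod.mk.injEq, not_and]
  cases s <;> cases t <;> simp

open Classical in
/-- The reduced words of length `ℓ`. -/
def redWords (k ℓ : ℕ) : Finset (List (Fin k × Bool)) :=
  (List.finite_length_eq (Fin k × Bool) ℓ).toFinset.filter FreeGroup.IsReduced

theorem mem_redWords {ℓ : ℕ} {l : List (Fin k × Bool)} :
    l ∈ redWords k ℓ ↔ l.length = ℓ ∧ FreeGroup.IsReduced l := by
  simp [redWords]

theorem redWords_add_one_cons {ℓ : ℕ} {l : List (Fin k × Bool)} (hl : l ∈ redWords k (ℓ + 1)) :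
    ∃ b t, l = b :: t := by
  cases l with
  | nil => simp [mem_redWords] at hl
  | cons b t => exact ⟨b, t, rfl⟩

theorem sum_redWords_add_two (ℓ : ℕ) (F : List (Fin k × Bool) → ℝ) :
    ∑ l ∈ redWords k (ℓ + 2), F l =
      ∑ l ∈ redWords k (ℓ + 1), ∑ a with ∀ b ∈ l.head?, a ≠ invL b, F (a :: l) := by
  rw [Finset.sum_sigma']
  symm
  refine Finset.sum_bij (fun x _ => x.2 :: x.1) ?_ ?_ ?_ ?_
  · rintro ⟨l, a⟩ h
    simp only [Finset.mem_sigma, Finset.mem_filter, Finset.mem_univ, true_and] at h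
    obtain ⟨b, t, rfl⟩ := redWords_add_one_cons h.1
    rw [mem_redWords] at h ⊢
    exact ⟨by simpa using h.1.1, isReduced_cons_cons_iff.2 ⟨h.2 b (by simp), h.1.2⟩⟩
  · rintro ⟨l, a⟩ - ⟨l', a'⟩ - h
    simp only [List.cons.injEq] at h
    simp [h]
  · intro l hl
    obtain ⟨a, t, rfl⟩ := redWords_add_one_cons hl
    cases t with
    | nil => simp [mem_redWords] at hl
    | cons b t =>
      rw [mem_redWords, isReduced_cons_cons_iff] at hl
      refine ⟨⟨b :: t, a⟩, ?_, rfl⟩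
      simp only [Finset.mem_sigma, mem_redWords, Finset.mem_filter, Finset.mem_univ, true_and]
      exact ⟨⟨by simpa using hl.1, hl.2.2⟩, by simpa using hl.2.1⟩
  · simp

theorem sum_ne_invL (b : Fin k × Bool) (f : Fin k × Bool → ℝ) :
    ∑ a with a ≠ invL b, f a = ∑ a, f a - f (invL b) := by
  rw [Finset.filter_ne', Finset.sum_erase_eq_sub (Finset.mem_univ _)]

theorem sum_one_ne_invL (b : Fin k × Bool) :
    ∑ a : Fin k × Bool with a ≠ invL b, (1 : ℝ) = 2 * k - 1 := by
  rw [sum_ne_invL]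
  simp [mul_comm]

theorem card_redWords_add_two (ℓ : ℕ) :
    ((redWords k (ℓ + 2)).card : ℝ) = (2 * k - 1) * (redWords k (ℓ + 1)).card := by
  have h := sum_redWords_add_two (k := k) ℓ fun _ => 1
  rw [Finset.sum_const, nsmul_one] at h
  rw [h, mul_comm, ← nsmul_eq_mul, ← Finset.sum_const]
  refine Finset.sum_congr rfl fun l hl => ?_
  obtain ⟨b, t, rfl⟩ := redWords_add_one_cons hl
  simpa [eq_comm] using sum_one_ne_invL b

theorem card_redWords_add (ℓ m : ℕ) :
    ((redWords k (ℓ + 1 + m)).card : ℝ) = (2 * k - 1) ^ m * (redWords k (ℓ + 1)).card := by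
  induction m with
  | zero => simp
  | succ m ih =>
    rw [show ℓ + 1 + (m + 1) = (ℓ + m) + 2 by ring, card_redWords_add_two,
      show ℓ + m + 1 = ℓ + 1 + m by ring, ih]
    ring

end Counting

section Concentration

variable {k : ℕ} {φ : Fin k × Bool → Fin k × Bool → ℝ}

/-- A centred function of pairs of consecutive letters is, up to a coboundary, centred given the
second letter. -/
theorem exists_coboundary (hk : 2 ≤ k) (hφ : ∀ a b, |φ a b| ≤ 1)
    (hφ0 : ∑ b, ∑ a with a ≠ invL b, φ a b = 0) :
    ∃ ψ : Fin k × Bool → ℝ, (∀ a, |ψ a| ≤ 2) ∧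
      ∀ b, ∑ a with a ≠ invL b, (φ a b + ψ a - ψ b) = 0 := by
  have hk' : (2 : ℝ) ≤ k := by exact_mod_cast hk
  obtain ⟨q, hq⟩ : ∃ q : ℝ, q = 2 * k - 1 := ⟨_, rfl⟩
  have hq3 : 3 ≤ q := by linarith
  have hq1 : 0 < q ^ 2 - 1 := by nlinarith
  set f : Fin k × Bool → ℝ := fun b => ∑ a with a ≠ invL b, φ a b with hf
  have hfq (b) : |f b| ≤ q := by
    refine (Finset.abs_sum_le_sum_abs _ _).trans ?_
    rw [hq, ← sum_one_ne_invL b]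
    exact Finset.sum_le_sum fun a _ => hφ a b
  have hfinv : ∑ b, f (invL b) = 0 := by
    rw [← hφ0]
    exact Equiv.sum_comp invL_involutive.toPerm f
  refine ⟨fun b => (q * f b - f (invL b)) / (q ^ 2 - 1), fun a => ?_, fun b => ?_⟩
  · rw [abs_div, abs_of_pos hq1, div_le_iff₀ hq1]
    have h1 := abs_le.1 (hfq a)
    have h2 := abs_le.1 (hfq (invL a))
    rw [abs_le]
    constructor <;> nlinarith [h1.1, h1.2, h2.1, h2.2]
  · rw [Finset.sum_sub_distrib, Finset.sum_add_distrib, sum_ne_invL b fun a =>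
      (q * f a - f (invL a)) / (q ^ 2 - 1), ← Finset.sum_div, Finset.sum_sub_distrib,
      ← Finset.mul_sum, hfinv, show ∑ a, f a = 0 from hφ0, invL_involutive b]
    have hc (c : ℝ) : ∑ a : Fin k × Bool with a ≠ invL b, c = c * q := by
      rw [hq, ← sum_one_ne_invL b, Finset.mul_sum]
      simp
    rw [hc]
    change f b + _ - _ = 0
    field_simp
    ring

theorem pairSum_add_coboundary {β : Type*} (φ : β → β → ℝ) (ψ : β → ℝ) (a : β) (l : List β) :
    pairSum (fun a b => φ a b + ψ a - ψ b) (a :: l) =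
      pairSum φ (a :: l) + ψ a - ψ ((a :: l).getLast (by simp)) := by
  induction l generalizing a with
  | nil => simp [pairSum]
  | cons b l ih =>
    rw [pairSum, ih, pairSum, List.getLast_cons (List.cons_ne_nil b l)]
    ring

/-- Exponential moments of a sum of bounded martingale differences over reduced words. -/
theorem sum_exp_pairSum_le (hk : 2 ≤ k) {B : ℝ} (hφ : ∀ a b, |φ a b| ≤ B)
    (hφ0 : ∀ b, ∑ a with a ≠ invL b, φ a b = 0) {t : ℝ} (ht : 0 ≤ t) (htB : t * B ≤ 1) (ℓ : ℕ) :
    ∑ l ∈ redWords k (ℓ + 1), Real.exp (t * pairSum φ l) ≤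
      (1 + (t * B) ^ 2) ^ ℓ * (redWords k (ℓ + 1)).card := by
  have hk' : (2 : ℝ) ≤ k := by exact_mod_cast hk
  induction ℓ with
  | zero =>
    rw [pow_zero, one_mul, Finset.card_eq_sum_ones, Nat.cast_sum]
    refine Finset.sum_le_sum fun l hl => ?_
    obtain ⟨b, s, rfl⟩ := redWords_add_one_cons hl
    have : s = [] := by simpa [mem_redWords] using (mem_redWords.1 hl).1
    simp [this, pairSum]
  | succ ℓ ih =>
    rw [sum_redWords_add_two, card_redWords_add_two]
    calc _ ≤ ∑ l ∈ redWords k (ℓ + 1),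
          Real.exp (t * pairSum φ l) * ((2 * k - 1) * (1 + (t * B) ^ 2)) := by
          refine Finset.sum_le_sum fun l hl => ?_
          obtain ⟨b, s, rfl⟩ := redWords_add_one_cons hl
          simp only [List.head?_cons, Option.mem_def, Option.some.injEq, forall_eq', pairSum]
          simp_rw [mul_add t, Real.exp_add]
          rw [← Finset.sum_mul, mul_comm]
          gcongr
          calc ∑ a with a ≠ invL b, Real.exp (t * φ a b)
              ≤ ∑ a with a ≠ invL b, (1 * (1 + (t * B) ^ 2) + t * φ a b) := by
                refine Finset.sum_le_sum fun a _ => ?_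
                have h1 : |t * φ a b| ≤ t * B := by
                  rw [abs_mul, abs_of_nonneg ht]
                  gcongr
                  exact hφ a b
                have h2 := (abs_le.1 (Real.abs_exp_sub_one_sub_id_le (h1.trans htB))).2
                have h3 := sq_le_sq' (abs_le.1 h1).1 (abs_le.1 h1).2
                linarith
            _ = _ := by
                rw [Finset.sum_add_distrib, ← Finset.sum_mul, ← Finset.mul_sum, hφ0,
                  sum_one_ne_invL]
                ring
      _ ≤ _ := by
          rw [← Finset.sum_mul]
          calc _ ≤ _ := mul_le_mul_of_nonneg_right ih (by
                have : (0 : ℝ) ≤ 2 * k - 1 := by linarith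
                positivity)
            _ = _ := by ring

theorem exists_card_pairSum_gt_le (hk : 2 ≤ k) (hφ : ∀ a b, |φ a b| ≤ 1)
    (hφ0 : ∑ b, ∑ a with a ≠ invL b, φ a b = 0) {η : ℝ} (hη : 0 < η) :
    ∃ C > 0, ∃ c > 0, ∀ ℓ : ℕ,
      (((redWords k (ℓ + 1)).filter fun l => η * (ℓ + 1 : ℕ) < pairSum φ l).card : ℝ) ≤
        C * Real.exp (-(c * (ℓ + 1 : ℕ))) * (redWords k (ℓ + 1)).card := by
  obtain ⟨ψ, hψ, hψ0⟩ := exists_coboundary hk hφ hφ0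
  have hB (a b) : |φ a b + ψ a - ψ b| ≤ 5 := by
    have h1 := abs_le.1 (hφ a b)
    have h2 := abs_le.1 (hψ a)
    have h3 := abs_le.1 (hψ b)
    rw [abs_le]
    constructor <;> linarith [h1.1, h1.2, h2.1, h2.2, h3.1, h3.2]
  obtain ⟨t, ht, ht5, htη⟩ : ∃ t > 0, t * 5 ≤ 1 ∧ (t * 5) ^ 2 ≤ t * η / 2 := by
    refine ⟨min (1 / 5) (η / 50), by positivity, ?_, ?_⟩
    · linarith [min_le_left (1 / 5) (η / 50)]
    · have h1 := min_le_right (1 / 5) (η / 50)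
      have h2 : 0 < min (1 / 5) (η / 50) := by positivity
      nlinarith
  refine ⟨Real.exp (4 * t), Real.exp_pos _, t * η / 2, by positivity, fun ℓ => ?_⟩
  have hmgf := sum_exp_pairSum_le hk hB hψ0 ht.le ht5 ℓ
  have hlow : ((redWords k (ℓ + 1)).filter fun l => η * (ℓ + 1 : ℕ) < pairSum φ l).card *
      Real.exp (t * (η * (ℓ + 1 : ℕ) - 4)) ≤
      ∑ l ∈ redWords k (ℓ + 1), Real.exp (t * pairSum (fun a b => φ a b + ψ a - ψ b) l) := by
    rw [← nsmul_eq_mul, ← Finset.sum_const]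
    refine (Finset.sum_le_sum fun l hl => ?_).trans (Finset.sum_le_sum_of_subset_of_nonneg
      (Finset.filter_subset _ _) fun _ _ _ => (Real.exp_pos _).le)
    rw [Finset.mem_filter] at hl
    obtain ⟨b, s, rfl⟩ := redWords_add_one_cons hl.1
    rw [pairSum_add_coboundary]
    have h1 := abs_le.1 (hψ b)
    have h2 := abs_le.1 (hψ ((b :: s).getLast (by simp)))
    refine Real.exp_le_exp.2 (mul_le_mul_of_nonneg_left ?_ ht.le)
    linarith [h1.1, h2.2, hl.2]
  have hpow : (1 + (t * 5) ^ 2) ^ ℓ ≤ Real.exp (t * η / 2 * (ℓ + 1 : ℕ)) := by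
    calc (1 + (t * 5) ^ 2) ^ ℓ ≤ Real.exp (t * η / 2) ^ ℓ := by
          gcongr
          linarith [Real.add_one_le_exp (t * η / 2)]
      _ = Real.exp (t * η / 2 * ℓ) := by rw [← Real.exp_nat_mul, mul_comm]
      _ ≤ _ := by gcongr; simp
  have h := hlow.trans (hmgf.trans (mul_le_mul_of_nonneg_right hpow (Nat.cast_nonneg _)))
  rw [← le_div_iff₀ (Real.exp_pos _)] at h
  refine h.trans_eq ?_
  rw [div_eq_iff (Real.exp_pos _).ne', mul_right_comm, ← Real.exp_add, ← Real.exp_add]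
  ring_nf

/-- Exponential concentration of centred pair sums over reduced words of a given length. -/
theorem exists_card_abs_pairSum_gt_le (hk : 2 ≤ k) (hφ : ∀ a b, |φ a b| ≤ 1)
    (hφ0 : ∑ b, ∑ a with a ≠ invL b, φ a b = 0) {η : ℝ} (hη : 0 < η) :
    ∃ C > 0, ∃ c > 0, ∀ ℓ : ℕ,
      (((redWords k (ℓ + 1)).filter fun l => η * (ℓ + 1 : ℕ) < |pairSum φ l|).card : ℝ) ≤
        C * Real.exp (-(c * (ℓ + 1 : ℕ))) * (redWords k (ℓ + 1)).card := by
  have hneg (l : List (Fin k × Bool)) : pairSum (fun a b => -φ a b) l = -pairSum φ l := by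
    induction l with
    | nil => simp [pairSum]
    | cons a l ih =>
      cases l with
      | nil => simp [pairSum]
      | cons b l => rw [pairSum, ih, pairSum]; ring
  obtain ⟨C₁, hC₁, c₁, hc₁, h₁⟩ := exists_card_pairSum_gt_le hk hφ hφ0 hη
  obtain ⟨C₂, hC₂, c₂, hc₂, h₂⟩ := exists_card_pairSum_gt_le (φ := fun a b => -φ a b) hk
    (by simpa using hφ) (by simpa using hφ0) hη
  refine ⟨C₁ + C₂, by positivity, min c₁ c₂, by positivity, fun ℓ => ?_⟩
  have hsub : ((redWords k (ℓ + 1)).filter fun l => η * (ℓ + 1 : ℕ) < |pairSum φ l|) ⊆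
      ((redWords k (ℓ + 1)).filter fun l => η * (ℓ + 1 : ℕ) < pairSum φ l) ∪
      ((redWords k (ℓ + 1)).filter fun l => η * (ℓ + 1 : ℕ) <
        pairSum (fun a b => -φ a b) l) := by
    intro l hl
    simp only [Finset.mem_union, Finset.mem_filter, hneg] at hl ⊢
    exact (lt_abs.1 hl.2).imp (⟨hl.1, ·⟩) (⟨hl.1, ·⟩)
  have hcard := (Finset.card_le_card hsub).trans (Finset.card_union_le _ _)
  refine (Nat.cast_le (α := ℝ).2 hcard).trans ?_
  rw [Nat.cast_add, add_mul, add_mul]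
  refine add_le_add ((h₁ ℓ).trans ?_) ((h₂ ℓ).trans ?_)
  · gcongr
    exact min_le_left _ _
  · gcongr
    exact min_le_right _ _

theorem abs_ite_sub_le {P : Prop} [Decidable P] {s : ℝ} (h0 : 0 ≤ s) (h1 : s ≤ 1) :
    |(if P then 1 else 0) - s| ≤ 1 := by
  rw [abs_le]
  split_ifs <;> constructor <;> linarith

theorem abs_letterDev_le (hk : 2 ≤ k) (u a b : Fin k × Bool) : |letterDev k u a b| ≤ 1 := by
  have hk' : (2 : ℝ) ≤ k := by exact_mod_cast hk
  exact abs_ite_sub_le (by positivity) ((div_le_one (by linarith)).2 (by linarith))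

theorem abs_pairDev_le (hk : 2 ≤ k) (u v a b : Fin k × Bool) : |pairDev k u v a b| ≤ 1 := by
  have hk' : (2 : ℝ) ≤ k := by exact_mod_cast hk
  have h : 1 ≤ 2 * (k : ℝ) * (2 * k - 1) := by nlinarith
  exact abs_ite_sub_le (by positivity) ((div_le_one (by linarith)).2 h)

theorem sum_letterDev (hk : 2 ≤ k) (u : Fin k × Bool) :
    ∑ b, ∑ a with a ≠ invL b, letterDev k u a b = 0 := by
  have hk' : (k : ℝ) ≠ 0 := by positivity
  have h0 : ∑ a, ((if a = u then 1 else 0) - 1 / (2 * k) : ℝ) = 0 := by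
    rw [Finset.sum_sub_distrib]
    simp
    field_simp
    ring
  have h1 : ∑ b, ((if invL b = u then 1 else 0) - 1 / (2 * k) : ℝ) = 0 := by
    exact (Equiv.sum_comp invL_involutive.toPerm
      fun a => ((if a = u then 1 else 0) - 1 / (2 * k) : ℝ)).trans h0
  simp only [letterDev, sum_ne_invL, h0, zero_sub, Finset.sum_neg_distrib, h1, neg_zero]

theorem sum_pairDev (hk : 2 ≤ k) {u v : Fin k × Bool} (huv : v ≠ invL u) :
    ∑ b, ∑ a with a ≠ invL b, pairDev k u v a b = 0 := by
  have hk' : (2 : ℝ) ≤ k := by exact_mod_cast hk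
  have hq : (2 * k - 1 : ℝ) ≠ 0 := by linarith
  have huv' : u ≠ invL v := by
    rintro rfl
    exact huv (invL_involutive v).symm
  have h1 : ∑ b, ∑ a with a ≠ invL b, (if (a, b) = (u, v) then (1 : ℝ) else 0) = 1 := by
    rw [Finset.sum_eq_single v, Finset.sum_eq_single u]
    · simp
    · intro a _ ha
      simp [ha]
    · intro h
      simp [huv'] at h
    · intro b _ hb
      simp [hb]
    · simp
  have h2 (b : Fin k × Bool) : ∑ a : Fin k × Bool with a ≠ invL b,
      (1 / (2 * k * (2 * k - 1)) : ℝ) = 1 / (2 * k) := by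
    rw [← mul_one (1 / (2 * k * (2 * k - 1)) : ℝ), ← Finset.mul_sum, sum_one_ne_invL]
    field_simp
  simp only [pairDev, Finset.sum_sub_distrib, h1, h2]
  simp
  field_simp
  ring

end Concentration

section RadialMeasure

open scoped ENNReal

instance FreeGroup.discreteMeasurableSpace {α : Type*} : DiscreteMeasurableSpace (FreeGroup α) :=
  ⟨fun _ => trivial⟩

instance FreeGroup.instCountable {α : Type*} [Countable α] : Countable (FreeGroup α) := by
  classical exact FreeGroup.toWord_injective.countable

variable {k : ℕ}

theorem card_filter_take_eq_le (P : List (Fin k × Bool)) (ℓ m : ℕ) :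
    ((redWords k (ℓ + m)).filter fun l => l.take m = P).card ≤ (redWords k ℓ).card := by
  refine Finset.card_le_card_of_injOn (List.drop m) ?_ ?_
  · intro l hl
    simp only [Finset.coe_filter, Set.mem_ofPred_eq, mem_redWords, Finset.mem_coe] at hl ⊢
    exact ⟨by simp [hl.1.1], hl.1.2.infix (List.drop_suffix _ _).isInfix⟩
  · intro l hl l' hl' h
    simp only [Finset.coe_filter, Set.mem_ofPred_eq] at hl hl'
    rw [← List.take_append_drop m l, ← List.take_append_drop m l', h, hl.2, hl'.2]

theorem card_filter_take_eq_take_invRev_le {ℓ m : ℕ} (hm : m ≤ ℓ) :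
    ((redWords k (ℓ + m)).filter fun l => l.take m = (FreeGroup.invRev l).take m).card ≤
      (redWords k ℓ).card := by
  refine Finset.card_le_card_of_injOn (List.take ℓ) ?_ ?_
  · intro l hl
    simp only [Finset.coe_filter, Set.mem_ofPred_eq, mem_redWords, Finset.mem_coe] at hl ⊢
    exact ⟨by simp [hl.1.1], hl.1.2.infix (List.take_prefix _ _).isInfix⟩
  · have key (l : List (Fin k × Bool)) (hlen : l.length = ℓ + m)
        (hl : l.take m = (FreeGroup.invRev l).take m) :
        l = l.take ℓ ++ FreeGroup.invRev ((l.take ℓ).take m) := by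
      have hinv : FreeGroup.invRev l =
          FreeGroup.invRev (l.drop ℓ) ++ FreeGroup.invRev (l.take ℓ) := by
        rw [← FreeGroup.invRev_append, List.take_append_drop]
      rw [List.take_take, min_eq_left hm, hl, hinv, List.take_append_of_le_length (by simp [hlen]),
        List.take_of_length_le (l := FreeGroup.invRev (l.drop ℓ)) (by simp [hlen]),
        FreeGroup.invRev_invRev, List.take_append_drop]
    intro l hl l' hl' h
    simp only [Finset.coe_filter, Set.mem_ofPred_eq, mem_redWords] at hl hl'
    rw [key l hl.1.1 hl.2, key l' hl'.1.1 hl'.2, h]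

variable {ν : Measure (FreeGroup (Fin k))}

theorem exists_measure_sphere_eq
    (hν : ∀ g g' : FreeGroup (Fin k), wlen g = wlen g' → ν {g} = ν {g'}) (ℓ : ℕ) :
    ∃ c : ℝ≥0∞, ∀ (P : List (Fin k × Bool) → Prop) [DecidablePred P],
      ν {g | wlen g = ℓ ∧ P g.toWord} = ((redWords k ℓ).filter P).card * c := by
  obtain ⟨c, hc⟩ : ∃ c : ℝ≥0∞, ∀ g : FreeGroup (Fin k), wlen g = ℓ → ν {g} = c := by
    by_cases h : ∃ g₀ : FreeGroup (Fin k), wlen g₀ = ℓ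
    · obtain ⟨g₀, h₀⟩ := h
      exact ⟨ν {g₀}, fun g hg => hν _ _ (hg.trans h₀.symm)⟩
    · exact ⟨0, fun g hg => absurd ⟨g, hg⟩ h⟩
  refine ⟨c, fun P _ => ?_⟩
  have hset : {g : FreeGroup (Fin k) | wlen g = ℓ ∧ P g.toWord} =
      ((((redWords k ℓ).filter P).image FreeGroup.mk : Finset (FreeGroup (Fin k))) :
        Set (FreeGroup (Fin k))) := by
    ext g
    simp only [Set.mem_ofPred_eq, Finset.coe_image, Set.mem_image, Finset.mem_coe,
      Finset.mem_filter, mem_redWords]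
    constructor
    · exact fun h => ⟨g.toWord, ⟨⟨h.1, FreeGroup.isReduced_toWord⟩, h.2⟩, FreeGroup.mk_toWord⟩
    · rintro ⟨l, ⟨⟨h1, h2⟩, h3⟩, rfl⟩
      rw [wlen, FreeGroup.toWord_mk, h2.reduce_eq]
      exact ⟨h1, h3⟩
  rw [hset, ← sum_measure_singleton, Finset.sum_image, ← nsmul_eq_mul, ← Finset.sum_const]
  · refine Finset.sum_congr rfl fun l hl => hc _ ?_
    rw [Finset.mem_filter, mem_redWords] at hl
    rw [wlen, FreeGroup.toWord_mk, hl.1.2.reduce_eq]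
    exact hl.1.1
  · intro l hl l' hl' h
    simp only [Finset.coe_filter, Set.mem_ofPred_eq, mem_redWords] at hl hl'
    rw [← hl.1.2.reduce_eq, ← hl'.1.2.reduce_eq]
    exact FreeGroup.reduce.sound h

/-- A property which is rare among reduced words of each length greater than `M` is unlikely for
a radial measure. -/
theorem measure_le_of_card_le [IsProbabilityMeasure ν]
    (hν : ∀ g g' : FreeGroup (Fin k), wlen g = wlen g' → ν {g} = ν {g'})
    (P : List (Fin k × Bool) → Prop) [DecidablePred P] {δ M : ℝ} (hδ : 0 ≤ δ)
    (h : ∀ ℓ : ℕ, M < ℓ →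
      (((redWords k ℓ).filter P).card : ℝ) ≤ δ * (redWords k ℓ).card) :
    ν {g | P g.toWord} ≤ ENNReal.ofReal δ + ν {g | ¬ M < wlen g} := by
  have hsub : {g : FreeGroup (Fin k) | P g.toWord} ⊆
      (⋃ ℓ : ℕ, {g | M < ℓ ∧ wlen g = ℓ ∧ P g.toWord}) ∪ {g | ¬ M < wlen g} := by
    intro g hg
    by_cases hM : M < wlen g
    · exact Or.inl (Set.mem_iUnion.2 ⟨wlen g, hM, rfl, hg⟩)
    · exact Or.inr hM
  refine (measure_mono hsub).trans ((measure_union_le _ _).trans ?_)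
  gcongr
  refine (measure_iUnion_le _).trans ?_
  have hle (ℓ : ℕ) : ν {g | M < ℓ ∧ wlen g = ℓ ∧ P g.toWord} ≤
      ENNReal.ofReal δ * ν {g | wlen g = ℓ} := by
    by_cases hM : M < ℓ
    · obtain ⟨c, hc⟩ := exists_measure_sphere_eq hν ℓ
      have h1 := hc P
      have h2 := hc fun _ => True
      simp only [and_true, Finset.filter_true] at h2
      simp only [hM, true_and]
      rw [h1, h2, ← mul_assoc]
      gcongr
      rw [← ENNReal.ofReal_natCast, ← ENNReal.ofReal_natCast (redWords k ℓ).card,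
        ← ENNReal.ofReal_mul hδ]
      exact ENNReal.ofReal_le_ofReal (h ℓ hM)
    · simp [hM]
  refine (ENNReal.tsum_le_tsum hle).trans ?_
  rw [ENNReal.tsum_mul_left, ← measure_iUnion]
  · exact mul_le_of_le_one_right' prob_le_one
  · intro i j hij
    refine Set.disjoint_left.2 fun g hi hj => hij ?_
    exact hi.symm.trans hj
  · exact fun _ => .of_discrete

theorem measure_inv_eq
    (hν : ∀ g g' : FreeGroup (Fin k), wlen g = wlen g' → ν {g} = ν {g'})
    (A : Set (FreeGroup (Fin k))) : ν {g | g⁻¹ ∈ A} = ν A := by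
  have hmap : ν.map (·⁻¹) = ν := by
    refine Measure.ext_of_singleton fun g => ?_
    rw [Measure.map_apply .of_discrete .of_discrete]
    have : (fun g : FreeGroup (Fin k) => g⁻¹) ⁻¹' {g} = {g⁻¹} := by
      ext x
      simp
    rw [this]
    exact hν _ _ (by simp [wlen, FreeGroup.toWord_inv])
  conv_rhs => rw [← hmap, Measure.map_apply .of_discrete .of_discrete]
  rfl

theorem card_le_inv_pow_mul (hk : 2 ≤ k) {ℓ m : ℕ} (hmℓ : m < ℓ) {N : ℕ}
    (hN : N ≤ (redWords k (ℓ - m)).card) :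
    (N : ℝ) ≤ ((2 * k - 1 : ℝ) ^ m)⁻¹ * (redWords k ℓ).card := by
  have hk' : (2 : ℝ) ≤ k := by exact_mod_cast hk
  have hq : (0 : ℝ) < 2 * k - 1 := by linarith
  have h := card_redWords_add (k := k) (ℓ - m - 1) m
  rw [show ℓ - m - 1 + 1 = ℓ - m by omega, show ℓ - m + m = ℓ by omega] at h
  rw [h, inv_mul_cancel_left₀ (by positivity)]
  exact_mod_cast hN

variable [IsProbabilityMeasure ν]

theorem measure_take_eq_le (hk : 2 ≤ k)
    (hν : ∀ g g' : FreeGroup (Fin k), wlen g = wlen g' → ν {g} = ν {g'})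
    (P : List (Fin k × Bool)) {m : ℕ} {M : ℝ} (hM : 2 * m ≤ M) :
    ν {g | g.toWord.take m = P} ≤
      ENNReal.ofReal ((2 * k - 1 : ℝ) ^ m)⁻¹ + ν {g | ¬ M < wlen g} := by
  have hk' : (2 : ℝ) ≤ k := by exact_mod_cast hk
  have hq : (0 : ℝ) < 2 * k - 1 := by linarith
  refine measure_le_of_card_le hν (fun l => l.take m = P) (by positivity) fun ℓ hℓ => ?_
  have hmℓ : 2 * m < ℓ := by exact_mod_cast hM.trans_lt hℓ
  refine card_le_inv_pow_mul hk (by omega) ?_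
  conv_lhs => rw [show ℓ = ℓ - m + m by omega]
  exact card_filter_take_eq_le P _ _

theorem measure_take_eq_take_inv_le (hk : 2 ≤ k)
    (hν : ∀ g g' : FreeGroup (Fin k), wlen g = wlen g' → ν {g} = ν {g'})
    {m : ℕ} {M : ℝ} (hM : 2 * m ≤ M) :
    ν {g | g.toWord.take m = g⁻¹.toWord.take m} ≤
      ENNReal.ofReal ((2 * k - 1 : ℝ) ^ m)⁻¹ + ν {g | ¬ M < wlen g} := by
  have hk' : (2 : ℝ) ≤ k := by exact_mod_cast hk
  have hq : (0 : ℝ) < 2 * k - 1 := by linarith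
  simp only [FreeGroup.toWord_inv]
  refine measure_le_of_card_le hν (fun l => l.take m = (FreeGroup.invRev l).take m)
    (by positivity) fun ℓ hℓ => ?_
  have hmℓ : 2 * m < ℓ := by exact_mod_cast hM.trans_lt hℓ
  refine card_le_inv_pow_mul hk (by omega) ?_
  conv_lhs => rw [show ℓ = ℓ - m + m by omega]
  exact card_filter_take_eq_take_invRev_le (by omega)

theorem exists_measure_abs_pairSum_gt_le (hk : 2 ≤ k) {φ : Fin k × Bool → Fin k × Bool → ℝ}
    (hφ : ∀ a b, |φ a b| ≤ 1) (hφ0 : ∑ b, ∑ a with a ≠ invL b, φ a b = 0) {η : ℝ}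
    (hη : 0 < η) :
    ∃ C > 0, ∃ c > 0, ∀ (ν : Measure (FreeGroup (Fin k))) [IsProbabilityMeasure ν],
      (∀ g g' : FreeGroup (Fin k), wlen g = wlen g' → ν {g} = ν {g'}) → ∀ M : ℝ, 0 ≤ M →
      ν {g | η * g.toWord.length < |pairSum φ g.toWord|} ≤
        ENNReal.ofReal (C * Real.exp (-(c * M))) + ν {g | ¬ M < wlen g} := by
  obtain ⟨C, hC, c, hc, h⟩ := exists_card_abs_pairSum_gt_le hk hφ hφ0 hη
  refine ⟨C, hC, c, hc, fun ν _ hν M hM => ?_⟩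
  refine measure_le_of_card_le hν (fun l => η * l.length < |pairSum φ l|) (by positivity)
    fun ℓ hℓ => ?_
  obtain ⟨ℓ, rfl⟩ : ∃ j, ℓ = j + 1 := Nat.exists_eq_add_one.2 (by exact_mod_cast hM.trans_lt hℓ)
  have hfilter : ((redWords k (ℓ + 1)).filter fun l => η * l.length < |pairSum φ l|) =
      (redWords k (ℓ + 1)).filter fun l => η * (ℓ + 1 : ℕ) < |pairSum φ l| :=
    Finset.filter_congr fun l hl => by rw [(mem_redWords.1 hl).1]
  rw [hfilter]
  refine (h ℓ).trans ?_
  gcongr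

end RadialMeasure

section ProductMeasure

open scoped ENNReal

variable {ι G : Type*} [Fintype ι] [MeasurableSpace G] [DiscreteMeasurableSpace G]
  (μ : ι → Measure G) [∀ i, IsProbabilityMeasure (μ i)]

theorem measure_pi_eval (i : ι) (A : Set G) : Measure.pi μ {w | w i ∈ A} = μ i A :=
  (measurePreserving_eval μ i).measure_preimage (MeasurableSet.of_discrete).nullMeasurableSet

theorem measure_pi_rel_le [Countable G] {i j : ι} (hij : i ≠ j) (R : G → G → Prop) {δ : ℝ≥0∞}
    (hR : ∀ y, μ i {x | R x y} ≤ δ) : Measure.pi μ {w | R (w i) (w j)} ≤ δ := by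
  have hsub : {w : ι → G | R (w i) (w j)} ⊆
      ⋃ y, {w | w i ∈ {x | R x y}} ∩ {w | w j ∈ ({y} : Set G)} := fun w hw =>
    Set.mem_iUnion.2 ⟨w j, hw, rfl⟩
  have hind := (ProbabilityTheory.iIndepFun_pi (μ := μ) (X := fun _ x => x)
    fun _ => aemeasurable_id).indepFun hij
  refine (measure_mono hsub).trans ((measure_iUnion_le _).trans ?_)
  calc ∑' y, Measure.pi μ ({w | w i ∈ {x | R x y}} ∩ {w | w j ∈ ({y} : Set G)})
      ≤ ∑' y, δ * μ j {y} := by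
        refine ENNReal.tsum_le_tsum fun y => ?_
        have h := hind.measure_inter_preimage_eq_mul {x | R x y} {y} .of_discrete .of_discrete
        refine h.trans_le ?_
        change Measure.pi μ {w | w i ∈ {x | R x y}} * Measure.pi μ {w | w j ∈ ({y} : Set G)} ≤ _
        rw [measure_pi_eval, measure_pi_eval]
        gcongr
        exact hR y
    _ = δ := by
        rw [ENNReal.tsum_mul_left, ← measure_iUnion]
        · rw [Set.iUnion_of_singleton, measure_univ, mul_one]
        · exact fun a b hab => Set.disjoint_singleton.2 hab
        · exact fun _ => .of_discrete

end ProductMeasure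

section ExponentialDecay

open scoped ENNReal

variable {f g : ℕ → ℝ≥0∞}

theorem ExpDecay.mono (hg : ExpDecay g) (h : ∀ n, f n ≤ g n) : ExpDecay f := by
  obtain ⟨C, hC, κ, hκ, hb⟩ := hg
  exact ⟨C, hC, κ, hκ, fun n => (h n).trans (hb n)⟩

theorem ExpDecay.add (hf : ExpDecay f) (hg : ExpDecay g) : ExpDecay fun n => f n + g n := by
  obtain ⟨C₁, hC₁, κ₁, hκ₁, h₁⟩ := hf
  obtain ⟨C₂, hC₂, κ₂, hκ₂, h₂⟩ := hg
  have hκ : 1 < min κ₁ κ₂ := lt_min hκ₁ hκ₂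
  have hκ0 : 0 < min κ₁ κ₂ := by linarith
  refine ⟨C₁ + C₂, by positivity, min κ₁ κ₂, hκ, fun n => ?_⟩
  rw [add_div, ENNReal.ofReal_add (by positivity) (by positivity)]
  refine add_le_add ((h₁ n).trans (ENNReal.ofReal_le_ofReal ?_))
    ((h₂ n).trans (ENNReal.ofReal_le_ofReal ?_))
  · gcongr
    exact min_le_left _ _
  · gcongr
    exact min_le_right _ _

theorem ExpDecay.zero : ExpDecay fun _ => 0 :=
  ⟨1, one_pos, 2, one_lt_two, fun _ => zero_le⟩

theorem ExpDecay.sum {ι : Type*} {F : ι → ℕ → ℝ≥0∞} (s : Finset ι)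
    (h : ∀ i ∈ s, ExpDecay (F i)) : ExpDecay fun n => ∑ i ∈ s, F i n := by
  classical
  induction s using Finset.induction_on with
  | empty => simpa using ExpDecay.zero
  | insert a s ha ih =>
    simp only [Finset.sum_insert ha]
    exact (h a (by simp)).add (ih fun i hi => h i (by simp [hi]))

theorem ExpDecay.of_eventually_le (hg : ExpDecay g) (hf : ∀ n, f n ≤ 1) {n₀ : ℕ}
    (h : ∀ n ≥ n₀, f n ≤ g n) : ExpDecay f := by
  obtain ⟨C, hC, κ, hκ, hb⟩ := hg
  have hκ0 : 0 < κ := by linarith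
  refine ⟨C + κ ^ n₀, by positivity, κ, hκ, fun n => ?_⟩
  rcases le_or_gt n₀ n with hn | hn
  · refine (h n hn).trans ((hb n).trans (ENNReal.ofReal_le_ofReal ?_))
    gcongr
    linarith [pow_pos hκ0 n₀]
  · refine (hf n).trans (ENNReal.one_le_ofReal.2 ?_)
    rw [one_le_div (by positivity)]
    linarith [pow_le_pow_right₀ hκ.le hn.le]

theorem expDecay_ofReal_exp (C : ℝ) {c : ℝ} (hc : 0 < c) :
    ExpDecay fun n => ENNReal.ofReal (C * Real.exp (-(c * n))) := by
  refine ⟨max C 1, by positivity, Real.exp c, Real.one_lt_exp_iff.2 hc, fun n => ?_⟩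
  beta_reduce
  rw [Real.exp_neg, ← div_eq_mul_inv, mul_comm c, Real.exp_nat_mul]
  gcongr
  exact le_max_left _ _

theorem ExpDecay.ofReal_inv_pow {q δ : ℝ} (hq : 1 < q) (hδ : 0 < δ) {m : ℕ → ℕ}
    (hm : ∀ n : ℕ, δ * n ≤ m n) : ExpDecay fun n => ENNReal.ofReal (q ^ m n)⁻¹ := by
  refine (expDecay_ofReal_exp 1 (mul_pos (Real.log_pos hq) hδ)).mono fun n =>
    ENNReal.ofReal_le_ofReal ?_
  rw [one_mul, Real.exp_neg]
  gcongr
  rw [← Real.rpow_natCast, Real.rpow_def_of_pos (by linarith), mul_assoc]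
  gcongr
  · exact (Real.log_pos hq).le
  · exact hm n

end ExponentialDecay

section GenericTuples

open scoped ENNReal

variable {k p : ℕ} {μ : ℕ → Fin p → Measure (FreeGroup (Fin k))} {L : ℝ}

theorem length_toWord_letterImage (w : Fin p → FreeGroup (Fin k)) (a : Fin p × Bool) :
    (letterImage w a).toWord.length = wlen (w a.1) := by
  rcases a with ⟨i, _ | _⟩ <;> simp [letterImage, wlen, FreeGroup.toWord_inv]

variable [∀ n i, IsProbabilityMeasure (μ n i)]

theorem measure_pi_letterImage
    (hradial : ∀ n i (g g' : FreeGroup (Fin k)), wlen g = wlen g' → μ n i {g} = μ n i {g'})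
    (n : ℕ) (a : Fin p × Bool) (A : Set (FreeGroup (Fin k))) :
    Measure.pi (μ n) {w | letterImage w a ∈ A} = μ n a.1 A := by
  rcases a with ⟨i, _ | _⟩
  · exact (measure_pi_eval (μ n) i {g | g⁻¹ ∈ A}).trans (measure_inv_eq (hradial n i) A)
  · exact measure_pi_eval (μ n) i A

theorem expDecay_abs_pairSum_gt (hk : 2 ≤ k)
    (hradial : ∀ n i (g g' : FreeGroup (Fin k)), wlen g = wlen g' → μ n i {g} = μ n i {g'})
    (hL : 0 < L) (hdrift : ∀ i, ExpDecay fun n => μ n i {g | ¬ (L * n < (wlen g : ℝ))})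
    {φ : Fin k × Bool → Fin k × Bool → ℝ} (hφ : ∀ a b, |φ a b| ≤ 1)
    (hφ0 : ∑ b, ∑ a with a ≠ invL b, φ a b = 0) {η : ℝ} (hη : 0 < η) (a : Fin p × Bool) :
    ExpDecay fun n => Measure.pi (μ n) {w | η * (letterImage w a).toWord.length <
      |pairSum φ (letterImage w a).toWord|} := by
  obtain ⟨C, hC, c, hc, h⟩ := exists_measure_abs_pairSum_gt_le hk hφ hφ0 hη
  refine ((expDecay_ofReal_exp C (mul_pos hc hL)).add (hdrift a.1)).mono fun n => ?_
  refine (measure_pi_letterImage hradial n a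
    {g | η * g.toWord.length < |pairSum φ g.toWord|}).trans_le ?_
  rw [mul_assoc]
  exact h (μ n a.1) (hradial n a.1) (L * n) (by positivity)

theorem expDecay_take_eq (hk : 2 ≤ k)
    (hradial : ∀ n i (g g' : FreeGroup (Fin k)), wlen g = wlen g' → μ n i {g} = μ n i {g'})
    (hdrift : ∀ i, ExpDecay fun n => μ n i {g | ¬ (L * n < (wlen g : ℝ))})
    {δ : ℝ} (hδ : 0 < δ) {m : ℕ → ℕ} (hδm : ∀ n : ℕ, δ * n ≤ m n) {n₀ : ℕ}
    (hmL : ∀ n ≥ n₀, 2 * m n ≤ L * n) {a b : Fin p × Bool} (hab : a ≠ b) :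
    ExpDecay fun n => Measure.pi (μ n) {w | (letterImage w a).toWord.take (m n) =
      (letterImage w b).toWord.take (m n)} := by
  have hk' : (2 : ℝ) ≤ k := by exact_mod_cast hk
  refine ((ExpDecay.ofReal_inv_pow (q := 2 * k - 1) (by linarith) hδ hδm).add
    (hdrift a.1)).of_eventually_le (fun n => prob_le_one) (n₀ := n₀) fun n hn => ?_
  by_cases h : a.1 = b.1
  · have hb : b = (a.1, !a.2) := by
      rcases a with ⟨i, s⟩
      rcases b with ⟨j, t⟩
      obtain rfl : i = j := h
      cases s <;> cases t <;> simp_all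
    subst hb
    simp only [letterImage_inv]
    refine (measure_pi_letterImage hradial n a
      {g | g.toWord.take (m n) = g⁻¹.toWord.take (m n)}).trans_le ?_
    exact measure_take_eq_take_inv_le hk (hradial n a.1) (hmL n hn)
  · refine measure_pi_rel_le (μ n) h (fun x y => (cond a.2 x x⁻¹).toWord.take (m n) =
      (cond b.2 y y⁻¹).toWord.take (m n)) fun y => ?_
    have hm := measure_take_eq_le hk (hradial n a.1)
      ((cond b.2 y y⁻¹).toWord.take (m n)) (hmL n hn)
    cases a.2 with
    | true => exact hm
    | false => exact (measure_inv_eq (hradial n a.1) {g | g.toWord.take (m n) = _}).trans_le hm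

end GenericTuples

/-- `μ n i` is the distribution of `w_{i,n}`; independence is expressed
by the product measure. Under radial symmetry, positive drift and subexponential growth,
for fixed `ε > 0`, with probability going to 1 exponentially fast: for every non-trivial
`g` in `H = ⟨w_{1,n}, …, w_{p,n}⟩`, the cyclic reduction of `g`, regarded as a cyclic
word, is `ε`-equidistributed. -/
theorem cyclic_reduction_equidistributed (k p : ℕ) (hk : 2 ≤ k) (hp : 1 ≤ p)
    (μ : ℕ → Fin p → Measure (FreeGroup (Fin k)))
    (hprob : ∀ n i, IsProbabilityMeasure (μ n i))
    (hradial : ∀ n i (g g' : FreeGroup (Fin k)), wlen g = wlen g' →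
      μ n i {g} = μ n i {g'})
    (L : ℝ) (hL : 0 < L)
    (hdrift : ∀ i, ExpDecay (fun n => μ n i {g | ¬ (L * n < (wlen g : ℝ))}))
    (hsubexp : ∀ θ : ℝ, 0 < θ → ∀ i,
      ExpDecay (fun n => μ n i {g | ¬ ((wlen g : ℝ) ≤ Real.exp (θ * n))}))
    (ε : ℝ) (hε : 0 < ε) :
    ExpDecay (fun n =>
      Measure.pi (μ n)
        {w : Fin p → FreeGroup (Fin k) |
          ¬ (∀ g : FreeGroup (Fin k), g ∈ Subgroup.closure (Set.range w) → g ≠ 1 →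
            ∀ c r : FreeGroup (Fin k), IsCyclicallyReduced r → g = c * r * c⁻¹ →
            EquiDistributed k ε (FreeGroup.toWord r))}) := by
  obtain ⟨c, hc, hcε⟩ : ∃ c > 0, c * (5 + 2 * ε) = ε / 2 :=
    ⟨ε / 2 / (5 + 2 * ε), by positivity, by field_simp⟩
  have hc4 : 2 * c ≤ 1 := by nlinarith
  obtain ⟨m, hm, hm1, n₀, hmL⟩ : ∃ m : ℕ → ℕ, (∀ n : ℕ, c * L / 2 * n ≤ m n) ∧ (∀ n, 1 ≤ m n) ∧
      ∃ n₀ : ℕ, ∀ n ≥ n₀, m n ≤ c * (L * n) := by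
    refine ⟨fun n => ⌊c * L / 2 * n⌋₊ + 1, fun n => ?_, fun n => by simp, ⌈2 / (c * L)⌉₊,
      fun n hn => ?_⟩
    · push_cast
      exact (Nat.lt_floor_add_one _).le
    · have h1 : 2 / (c * L) ≤ n := (Nat.le_ceil _).trans (by exact_mod_cast hn)
      rw [div_le_iff₀ (by positivity)] at h1
      have h2 := Nat.floor_le (a := c * L / 2 * n) (by positivity)
      push_cast
      linarith
  have hmL' : ∀ n ≥ n₀, 2 * m n ≤ L * n := fun n hn => by
    have := mul_le_mul_of_nonneg_right hc4 (by positivity : 0 ≤ L * n)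
    linarith [hmL n hn]
  let short (i : Fin p) (n : ℕ) : Set (Fin p → FreeGroup (Fin k)) :=
    {w | w i ∈ {g | ¬ (L * n < (wlen g : ℝ))}}
  let deviates (φ : Fin k × Bool → Fin k × Bool → ℝ) (a : Fin p × Bool) :
      Set (Fin p → FreeGroup (Fin k)) :=
    {w | ε / 2 * (letterImage w a).toWord.length < |pairSum φ (letterImage w a).toWord|}
  let overlap (x : {x : (Fin p × Bool) × (Fin p × Bool) // x.1 ≠ x.2}) (n : ℕ) :
      Set (Fin p → FreeGroup (Fin k)) :=
    {w | (letterImage w x.1.1).toWord.take (m n) = (letterImage w x.1.2).toWord.take (m n)}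
  have hshort : ExpDecay fun n => ∑ i, Measure.pi (μ n) (short i n) :=
    ExpDecay.sum _ fun i _ => (hdrift i).mono fun n => (measure_pi_eval (μ n) i _).le
  have hletter : ExpDecay fun n => ∑ x : (Fin k × Bool) × (Fin p × Bool),
      Measure.pi (μ n) (deviates (letterDev k x.1) x.2) :=
    ExpDecay.sum _ fun x _ => expDecay_abs_pairSum_gt hk hradial hL hdrift
      (abs_letterDev_le hk x.1) (sum_letterDev hk x.1) (by positivity) x.2
  have hpair : ExpDecay fun n =>
      ∑ x : {y : (Fin k × Bool) × (Fin k × Bool) // y.2 ≠ invL y.1} × (Fin p × Bool),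
        Measure.pi (μ n) (deviates (pairDev k x.1.1.1 x.1.1.2) x.2) :=
    ExpDecay.sum _ fun x _ => expDecay_abs_pairSum_gt hk hradial hL hdrift
      (abs_pairDev_le hk x.1.1.1 x.1.1.2) (sum_pairDev hk x.1.2) (by positivity) x.2
  have hoverlap : ExpDecay fun n => ∑ x, Measure.pi (μ n) (overlap x n) :=
    ExpDecay.sum _ fun x _ => expDecay_take_eq hk hradial hdrift (by positivity) hm hmL' x.2
  refine (hshort.add (hletter.add (hpair.add hoverlap))).of_eventually_le
    (fun n => prob_le_one) (n₀ := n₀) fun n hn => ?_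
  refine (measure_mono (t := (⋃ i, short i n) ∪
    ((⋃ x : (Fin k × Bool) × (Fin p × Bool), deviates (letterDev k x.1) x.2) ∪
    ((⋃ x : {y : (Fin k × Bool) × (Fin k × Bool) // y.2 ≠ invL y.1} × (Fin p × Bool),
      deviates (pairDev k x.1.1.1 x.1.1.2) x.2) ∪ ⋃ x, overlap x n))) ?_).trans ?_
  · intro w hw
    by_contra hgood
    refine hw fun g hg hg1 c' r hr hgr => ?_
    simp only [Set.mem_union, Set.mem_iUnion, not_or, not_exists, short, deviates, overlap,
      Set.mem_ofPred_eq, not_lt] at hgood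
    obtain ⟨hlong, hlet, hpr, hsep⟩ := hgood
    have hmlen (a : Fin p × Bool) : (m n : ℝ) ≤ c * (letterImage w a).toWord.length := by
      rw [length_toWord_letterImage]
      exact (hmL n hn).trans (by gcongr; exact (not_le.1 (hlong a.1)).le)
    have hlen (a : Fin p × Bool) : 2 * m n ≤ (letterImage w a).toWord.length := by
      have h1 := hmlen a
      have h2 := mul_le_mul_of_nonneg_right hc4
        (Nat.cast_nonneg (α := ℝ) (letterImage w a).toWord.length)
      have h3 : (2 * m n : ℝ) ≤ (letterImage w a).toWord.length := by linarith
      exact_mod_cast h3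
    have hbound {φ : Fin k × Bool → Fin k × Bool → ℝ} (hφ : ∀ a b, |φ a b| ≤ 1)
        (hdev : ∀ a, |pairSum φ (letterImage w a).toWord| ≤
          ε / 2 * (letterImage w a).toWord.length)
        {h : Fin k × Bool} {t : List (Fin k × Bool)} (hht : r.toWord = h :: t) :
        |pairSum φ (h :: t ++ [h])| ≤ ε * (h :: t).length := by
      refine (abs_cyclic_pairSum_le hφ hε.le (fun x hx => abs_pairSum_le_of_mem_closure hφ (hm1 n)
        hε.le hlen (fun a => ?_) (fun a b hab => hsep ⟨(a, b), hab⟩) hx) (hgr ▸ hg) hr hht).trans_eq (by rw [hht])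
      have h1 := mul_le_mul_of_nonneg_right (hmlen a) (by positivity : 0 ≤ 5 + 2 * ε)
      rw [mul_right_comm, hcε] at h1
      linarith [hdev a]
    cases hht : r.toWord with
    | nil =>
      rw [FreeGroup.toWord_eq_nil_iff] at hht
      exact absurd (by simp [hgr, hht]) hg1
    | cons h t =>
      exact equiDistributed_of_abs_pairSum_le
        (fun u => hbound (abs_letterDev_le hk u) (fun a => hlet (u, a)) hht)
        (fun u v huv => hbound (abs_pairDev_le hk u v)
          (fun a => hpr (⟨(u, v), huv⟩, a)) hht)
  · refine (measure_union_le _ _).trans (add_le_add (measure_iUnion_fintype_le _ _) ?_)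
    refine (measure_union_le _ _).trans (add_le_add (measure_iUnion_fintype_le _ _) ?_)
    exact (measure_union_le _ _).trans
      (add_le_add (measure_iUnion_fintype_le _ _) (measure_iUnion_fintype_le _ _))

end
end

section
/- Let k ≥ 1 be an integer. Let H be a finitely generated group acting on an infinite set 𝒳 with finitely many orbits, such that the stabilizer of every point of 𝒳 is slender. Then there exists a graph Δ with vertex set 𝒳 whose adjacency relation is H-invariant (so the action of H on 𝒳 extends to an action on Δ by graph automorphisms) such that: (1) Δ has finitely many H-orbits of edges, and (2) Δ is k-connected, meaning that for every set S of at most k−1 vertices, the induced subgraph of Δ on 𝒳 ∖ S is connected. -/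
/-- A group is slender if all of its subgroups are finitely generated. -/
def Slender (G : Type*) [Group G] : Prop := ∀ K : Subgroup G, K.FG

open Relation in
/-- If a path may pass through `p` but starts and ends elsewhere, and the points adjacent to `p` are
linked by `T`, then the visits to `p` can be replaced by detours through `T`. -/
theorem Relation.ReflTransGen.detour {X : Type*} {r T : X → X → Prop} {p u v : X}
    (hsymm : ∀ a b, r a b → r b a)
    (hT : ∀ a b, r a b → a ≠ p → b ≠ p → T a b)
    (hp : ∀ a b, r p a → r p b → a ≠ p → b ≠ p → ReflTransGen T a b)
    (h : ReflTransGen r u v) (hu : u ≠ p) (hv : v ≠ p) : ReflTransGen T u v := by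
  suffices H : (v ≠ p → ReflTransGen T u v) ∧
      (v = p → ∀ b, r p b → b ≠ p → ReflTransGen T u b) from H.1 hv
  clear hv
  induction h with
  | refl => exact ⟨fun _ => .refl, fun h => absurd h hu⟩
  | @tail w w' _ hww ih =>
    by_cases hw : w = p
    · subst hw
      exact ⟨fun hw' => ih.2 rfl _ hww hw', fun _ => ih.2 rfl⟩
    · refine ⟨fun hw' => (ih.1 hw).tail (hT _ _ hww hw hw'), ?_⟩
      rintro rfl b hb hbp
      exact (ih.1 hw).trans (hp _ _ (hsymm _ _ hww) hb hw hbp)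

namespace MulAction

variable {H X : Type*} [Group H] [MulAction H X]

/-- The union of the `K`-orbits of the pairs in `E`, as a relation. -/
def OrbitAdj (K : Subgroup H) (E : Set (X × X)) (a b : X) : Prop :=
  ∃ h ∈ K, ∃ e ∈ E, h • e.1 = a ∧ h • e.2 = b

/-- The union of the `K`-orbits of the points in `F`. -/
def orbitUnion (K : Subgroup H) (F : Set X) : Set X :=
  {x | ∃ h ∈ K, ∃ f ∈ F, h • f = x}

/-- The relation `r` restricted to the complement of `S`. -/
def AvoidAdj (r : X → X → Prop) (S : Finset X) (a b : X) : Prop :=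
  r a b ∧ a ∉ S ∧ b ∉ S

theorem OrbitAdj.smul {K : Subgroup H} {E : Set (X × X)} {a b : X} (h : OrbitAdj K E a b)
    {g : H} (hg : g ∈ K) : OrbitAdj K E (g • a) (g • b) := by
  obtain ⟨k, hk, e, he, rfl, rfl⟩ := h
  exact ⟨g * k, K.mul_mem hg hk, e, he, mul_smul _ _ _, mul_smul _ _ _⟩

theorem OrbitAdj.mono {K L : Subgroup H} {E E' : Set (X × X)} {a b : X}
    (h : OrbitAdj K E a b) (hK : K ≤ L) (hE : E ⊆ E') : OrbitAdj L E' a b := by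
  obtain ⟨k, hk, e, he, h⟩ := h
  exact ⟨k, hK hk, e, hE he, h⟩

theorem OrbitAdj.symm {K : Subgroup H} {E : Set (X × X)} (hE : ∀ e ∈ E, e.swap ∈ E) {a b : X}
    (h : OrbitAdj K E a b) : OrbitAdj K E b a := by
  obtain ⟨k, hk, e, he, h1, h2⟩ := h
  exact ⟨k, hk, e.swap, hE e he, h2, h1⟩

theorem smul_mem_orbitUnion {K : Subgroup H} {F : Set X} {x : X} (h : x ∈ orbitUnion K F)
    {g : H} (hg : g ∈ K) : g • x ∈ orbitUnion K F := by
  obtain ⟨k, hk, f, hf, rfl⟩ := h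
  exact ⟨g * k, K.mul_mem hg hk, f, hf, mul_smul _ _ _⟩

theorem OrbitAdj.mem_orbitUnion {K : Subgroup H} {E : Set (X × X)} {F : Set X}
    (hE : E ⊆ orbitUnion K F ×ˢ orbitUnion K F) {a b : X} (h : OrbitAdj K E a b) :
    a ∈ orbitUnion K F ∧ b ∈ orbitUnion K F := by
  obtain ⟨k, hk, e, he, rfl, rfl⟩ := h
  exact ⟨smul_mem_orbitUnion (hE he).1 hk, smul_mem_orbitUnion (hE he).2 hk⟩

/-- `E` is a finite symmetric set of pairs in `orbitUnion K F` whose `K`-orbits form a graph on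
`orbitUnion K F` that stays preconnected after the removal of fewer than `k` points. -/
structure IsConnectingSet (k : ℕ) (K : Subgroup H) (F : Set X) (E : Set (X × X)) : Prop where
  finite : E.Finite
  swap_mem : ∀ e ∈ E, e.swap ∈ E
  subset : E ⊆ orbitUnion K F ×ˢ orbitUnion K F
  reflTransGen : ∀ S : Finset X, S.card < k → ∀ u ∈ orbitUnion K F, ∀ v ∈ orbitUnion K F,
    u ∉ S → v ∉ S → Relation.ReflTransGen (AvoidAdj (OrbitAdj K E) S) u v

/-- The neighbours of `x` fall into finitely many orbits under the stabilizer of `x` in `K`. -/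
theorem exists_finite_orbitUnion_eq_neighbors (K : Subgroup H) {E : Set (X × X)} (hE : E.Finite)
    (x : X) : ∃ F : Set X, F.Finite ∧
      orbitUnion (K ⊓ stabilizer H x) F = {y | OrbitAdj K E x y ∧ y ≠ x} := by
  classical
  have key : ∀ e : X × X, ∃ g : H, (∃ h ∈ K, h • e.1 = x) → g ∈ K ∧ g • e.1 = x := by
    intro e
    by_cases h : ∃ h ∈ K, h • e.1 = x
    · obtain ⟨g, hg⟩ := h
      exact ⟨g, fun _ => hg⟩
    · exact ⟨1, fun h' => absurd h' h⟩
  choose g hg using key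
  refine ⟨(fun e : X × X => g e • e.2) '' {e ∈ E | (∃ h ∈ K, h • e.1 = x) ∧ e.1 ≠ e.2},
    (hE.subset (Set.sep_subset _ _)).image _, ?_⟩
  ext y
  constructor
  · rintro ⟨h, ⟨hK, hx⟩, _, ⟨e, ⟨he, hex, hne⟩, rfl⟩, rfl⟩
    obtain ⟨hgK, hgx⟩ := hg e hex
    have hx : h • x = x := hx
    refine ⟨⟨h * g e, K.mul_mem hK hgK, e, he, ?_, mul_smul _ _ _⟩, ?_⟩
    · rw [mul_smul, hgx, hx]
    · intro hy
      apply hne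
      have : h • g e • e.2 = h • g e • e.1 := by rw [hgx, hx]; exact hy
      exact (MulAction.injective _ (MulAction.injective _ this)).symm
  · rintro ⟨⟨h, hK, e, he, h1, rfl⟩, hy⟩
    obtain ⟨hgK, hgx⟩ := hg e ⟨h, hK, h1⟩
    refine ⟨h * (g e)⁻¹, ⟨K.mul_mem hK (K.inv_mem hgK), ?_⟩, g e • e.2,
      ⟨e, ⟨he, ⟨h, hK, h1⟩, ?_⟩, rfl⟩, ?_⟩
    · change (h * (g e)⁻¹) • x = x
      rw [mul_smul, inv_smul_eq_iff.2 hgx.symm, h1]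
    · intro h'
      rw [← h'] at hy
      exact hy h1
    · simp [mul_smul]

/-- A finitely generated group acting with finitely many orbits preserves a connected graph with
finitely many orbits of edges. -/
theorem exists_isConnectingSet_one {K : Subgroup H} (hK : K.FG) {F : Set X} (hF : F.Finite) :
    ∃ E : Set (X × X), IsConnectingSet 1 K F E := by
  obtain ⟨T, rfl⟩ := hK
  set K := Subgroup.closure (T : Set H)
  set A : Set (X × X) := F ×ˢ F ∪ (fun q : H × X => (q.2, q.1 • q.2)) '' ((T : Set H) ×ˢ F)
  have hF_sub : ∀ f ∈ F, f ∈ orbitUnion K F := fun f hf => ⟨1, K.one_mem, f, hf, one_smul _ _⟩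
  have hA : A ⊆ orbitUnion K F ×ˢ orbitUnion K F := by
    rintro _ (⟨h1, h2⟩ | ⟨q, ⟨hq1, hq2⟩, rfl⟩)
    · exact ⟨hF_sub _ h1, hF_sub _ h2⟩
    · exact ⟨hF_sub _ hq2, q.1, Subgroup.subset_closure hq1, q.2, hq2, rfl⟩
  have hA_fin : A.Finite := (hF.prod hF).union ((T.finite_toSet.prod hF).image _)
  have hswap : ∀ e ∈ A ∪ Prod.swap '' A, e.swap ∈ A ∪ Prod.swap '' A := by
    rintro e (h | ⟨e, h, rfl⟩)
    · exact Or.inr ⟨e, h, rfl⟩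
    · exact Or.inl (by simpa using h)
  refine ⟨A ∪ Prod.swap '' A, hA_fin.union (hA_fin.image _), hswap, ?_, ?_⟩
  · rintro e (h | ⟨e, h, rfl⟩)
    · exact hA h
    · exact ⟨(hA h).2, (hA h).1⟩
  intro S hS
  obtain rfl : S = ∅ := by simpa using hS
  set r : X → X → Prop := AvoidAdj (OrbitAdj K (A ∪ Prod.swap '' A)) ∅
  have hr : ∀ a b, OrbitAdj K (A ∪ Prod.swap '' A) a b → r a b := fun a b h => ⟨h, by simp⟩
  have hsymm : Std.Symm r := ⟨fun a b h => hr _ _ (h.1.symm hswap)⟩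
  have hsmul : ∀ g ∈ K, ∀ a b, Relation.ReflTransGen r a b →
      Relation.ReflTransGen r (g • a) (g • b) := fun g hg a b h =>
    Relation.ReflTransGen.lift (p := r) (g • ·) (fun _ _ h => hr _ _ (h.1.smul hg)) _ _ h
  have hbase : ∀ e ∈ A, r e.1 e.2 := fun e he =>
    hr _ _ ⟨1, K.one_mem, e, Or.inl he, one_smul _ _, one_smul _ _⟩
  have horbit : ∀ g ∈ K, ∀ f ∈ F, Relation.ReflTransGen r f (g • f) := by
    intro g hg f hf
    induction hg using Subgroup.closure_induction with
    | mem t ht => exact .single (hbase (f, t • f) (Or.inr ⟨(t, f), ⟨ht, hf⟩, rfl⟩))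
    | one => rw [one_smul]
    | mul a b ha hb iha ihb =>
      rw [mul_smul]
      exact iha.trans (hsmul a ha _ _ ihb)
    | inv a ha iha =>
      have := hsmul a⁻¹ (K.inv_mem ha) _ _ iha
      rw [inv_smul_smul] at this
      exact symm_of (Relation.ReflTransGen r) this
  rintro _ ⟨g, hg, f, hf, rfl⟩ _ ⟨g', hg', f', hf', rfl⟩ - -
  exact ((symm_of (Relation.ReflTransGen r) (horbit g hg f hf)).tail
    (hbase (f, f') (Or.inl ⟨hf, hf'⟩))).trans (horbit g' hg' f' hf')

/-- Adding, at every vertex `x`, a graph on the neighbours of `x` that survives the removal of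
fewer than `k` points improves the connectivity from `k` to `k + 1`. -/
theorem IsConnectingSet.succ {k : ℕ} (hk : 1 ≤ k) {K : Subgroup H} {F : Set X} {E : Set (X × X)}
    (hE : IsConnectingSet k K F E) {N : X → Set X} {L : X → Set (X × X)}
    (hN : ∀ x, orbitUnion (K ⊓ stabilizer H x) (N x) = {y | OrbitAdj K E x y ∧ y ≠ x})
    (hL : ∀ x, IsConnectingSet k (K ⊓ stabilizer H x) (N x) (L x)) :
    IsConnectingSet (k + 1) K F (E ∪ ⋃ e ∈ E, L e.1) := by
  classical
  refine ⟨hE.finite.union (hE.finite.biUnion fun e _ => (hL e.1).finite), ?_, ?_, ?_⟩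
  · rintro e (h | h)
    · exact Or.inl (hE.swap_mem e h)
    · simp only [Set.mem_iUnion] at h
      obtain ⟨d, hd, h⟩ := h
      exact Or.inr (Set.mem_biUnion hd ((hL _).swap_mem e h))
  · rintro e (h | h)
    · exact hE.subset h
    · simp only [Set.mem_iUnion] at h
      obtain ⟨d, hd, h⟩ := h
      have h' := (hL _).subset h
      rw [hN] at h'
      exact ⟨(h'.1.1.mem_orbitUnion hE.subset).2, (h'.2.1.mem_orbitUnion hE.subset).2⟩
  intro S hS u hu v hv huS hvS
  rcases S.eq_empty_or_nonempty with rfl | ⟨p, hp⟩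
  · exact Relation.ReflTransGen.mono
      (fun a b h => ⟨h.1.mono le_rfl Set.subset_union_left, h.2⟩) _ _
      (hE.reflTransGen ∅ (by simpa using Nat.pos_of_ne_zero (by omega)) u hu v hv huS hvS)
  have hcard : (S.erase p).card < k := by
    rw [Finset.card_erase_of_mem hp]
    omega
  have hS_mem : ∀ a, a ≠ p → a ∉ S.erase p → a ∉ S := fun a h1 h2 h3 =>
    h2 (Finset.mem_erase.2 ⟨h1, h3⟩)
  refine Relation.ReflTransGen.detour (p := p) ?_ ?_ ?_
    (hE.reflTransGen (S.erase p) hcard u hu v hv (fun h => huS (Finset.mem_of_mem_erase h))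
      (fun h => hvS (Finset.mem_of_mem_erase h)))
    (fun h => huS (h ▸ hp)) (fun h => hvS (h ▸ hp))
  · exact fun a b h => ⟨h.1.symm hE.swap_mem, h.2.2, h.2.1⟩
  · exact fun a b h ha hb => ⟨h.1.mono le_rfl Set.subset_union_left,
      hS_mem a ha h.2.1, hS_mem b hb h.2.2⟩
  intro a b ha hb hap hbp
  obtain ⟨g, hg, e, he, hgp, -⟩ := ha.1
  have hmem : ∀ y, OrbitAdj K E p y → y ≠ p →
      g⁻¹ • y ∈ orbitUnion (K ⊓ stabilizer H e.1) (N e.1) := by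
    intro y hy hyp
    rw [hN]
    have h := hy.smul (K.inv_mem hg)
    rw [← hgp, inv_smul_smul] at h
    refine ⟨h, fun h' => hyp ?_⟩
    rw [← hgp, ← h', smul_inv_smul]
  have hnot : ∀ y, y ∉ S.erase p → g⁻¹ • y ∉ (S.erase p).image (g⁻¹ • ·) := by
    intro y hy h
    obtain ⟨z, hz, h⟩ := Finset.mem_image.1 h
    exact hy (MulAction.injective _ h ▸ hz)
  have hpath := (hL e.1).reflTransGen ((S.erase p).image (g⁻¹ • ·))
    (Finset.card_image_le.trans_lt hcard) _ (hmem a ha.1 hap) _ (hmem b hb.1 hbp)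
    (hnot a ha.2.2) (hnot b hb.2.2)
  have hback : ∀ y, y ∈ orbitUnion (K ⊓ stabilizer H e.1) (N e.1) →
      y ∉ (S.erase p).image (g⁻¹ • ·) → g • y ∉ S := by
    intro y hy hyS
    refine hS_mem _ ?_ fun h => hyS (Finset.mem_image.2 ⟨_, h, inv_smul_smul _ _⟩)
    rw [hN] at hy
    rw [← hgp]
    exact fun h => hy.2 (MulAction.injective _ h)
  have := Relation.ReflTransGen.lift
    (r := AvoidAdj (OrbitAdj (K ⊓ stabilizer H e.1) (L e.1)) ((S.erase p).image (g⁻¹ • ·)))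
    (p := AvoidAdj (OrbitAdj K (E ∪ ⋃ e ∈ E, L e.1)) S) (g • ·) (fun c d h => by
      have hcd := h.1.mem_orbitUnion (hL e.1).subset
      refine ⟨(h.1.mono inf_le_left ?_).smul hg, hback c hcd.1 h.2.1, hback d hcd.2 h.2.2⟩
      exact fun _ h => Or.inr (Set.mem_biUnion he h)) _ _ hpath
  simpa [Function.onFun] using this

theorem inf_stabilizer_fg {x : X} (hx : Slender (stabilizer H x)) (K : Subgroup H) :
    (K ⊓ stabilizer H x).FG := by
  obtain ⟨T, hT, hT_fin⟩ := (Subgroup.fg_iff _).1 (hx (K.subgroupOf (stabilizer H x)))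
  refine (Subgroup.fg_iff _).2 ⟨_, ?_, hT_fin.image (stabilizer H x).subtype⟩
  rw [← MonoidHom.map_closure, hT, Subgroup.subgroupOf_map_subtype]

theorem exists_isConnectingSet (hstab : ∀ x : X, Slender (stabilizer H x)) {k : ℕ} (hk : 1 ≤ k)
    {K : Subgroup H} (hK : K.FG) {F : Set X} (hF : F.Finite) :
    ∃ E : Set (X × X), IsConnectingSet k K F E := by
  induction k, hk using Nat.le_induction generalizing K F with
  | base => exact exists_isConnectingSet_one hK hF
  | succ k hk ih =>
    obtain ⟨E, hE⟩ := ih hK hF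
    choose N hN_fin hN using exists_finite_orbitUnion_eq_neighbors K hE.finite
    choose L hL using fun x => ih (inf_stabilizer_fg (hstab x) K) (hN_fin x)
    exact ⟨_, hE.succ hk hN hL⟩

end MulAction

/-- Let `k ≥ 1`. Let `H` be a finitely generated group acting on an
infinite set `X` with finitely many orbits, all of whose point stabilizers are slender.
Then there is a graph `Δ` with vertex set `X`, with `H`-invariant adjacency relation,
having finitely many `H`-orbits of edges, and which is `k`-connected: removing at most
`k − 1` vertices leaves it connected. -/
theorem extend_action_to_connected_graph (k : ℕ) (hk : 1 ≤ k)
    (H : Type*) [Group H] (hHfg : Group.FG H)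
    (X : Type*) [Infinite X] [MulAction H X]
    (horb : Finite (MulAction.orbitRel.Quotient H X))
    (hstab : ∀ x : X, Slender (MulAction.stabilizer H x)) :
    ∃ Δ : SimpleGraph X,
      (∀ (h : H) (x y : X), Δ.Adj x y → Δ.Adj (h • x) (h • y)) ∧
      (∃ S : Finset (Sym2 X), ∀ e ∈ Δ.edgeSet,
        ∃ (h : H), ∃ e' ∈ S, e = Sym2.map (fun z => h • z) e') ∧
      (∀ S : Finset X, S.card ≤ k - 1 →
        (Δ.induce ((↑S : Set X)ᶜ)).Connected) := by
  classical
  set F : Set X := Set.range (Quotient.out : MulAction.orbitRel.Quotient H X → X)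
  have hF : ∀ x, x ∈ MulAction.orbitUnion (⊤ : Subgroup H) F := by
    intro x
    obtain ⟨h, hx⟩ := (MulAction.orbitRel_apply (G := H)).1
      ((MulAction.orbitRel H X).symm (Quotient.mk_out (s := MulAction.orbitRel H X) x))
    exact ⟨h, trivial, _, ⟨_, rfl⟩, hx⟩
  obtain ⟨E, hE⟩ := MulAction.exists_isConnectingSet hstab hk hHfg.out
    (Set.finite_range _ : F.Finite)
  let Δ : SimpleGraph X :=
    { Adj := fun a b => a ≠ b ∧ MulAction.OrbitAdj (⊤ : Subgroup H) E a b
      symm := ⟨fun _ _ h => ⟨h.1.symm, h.2.symm hE.swap_mem⟩⟩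
      loopless := ⟨fun _ h => h.1 rfl⟩ }
  refine ⟨Δ, ?_, ⟨hE.finite.toFinset.image fun e => s(e.1, e.2), ?_⟩, ?_⟩
  · exact fun h x y hxy => ⟨fun h' => hxy.1 (MulAction.injective _ h'), hxy.2.smul trivial⟩
  · intro e
    induction e with
    | _ a b =>
      rintro ⟨-, h, -, e, he, rfl, rfl⟩
      exact ⟨h, s(e.1, e.2), Finset.mem_image.2 ⟨e, hE.finite.mem_toFinset.2 he, rfl⟩, rfl⟩
  · intro S hS
    have : Nonempty ((↑S : Set X)ᶜ : Set X) := S.finite_toSet.infinite_compl.nonempty.to_subtype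
    refine ⟨fun ⟨u, hu⟩ ⟨v, hv⟩ => ?_⟩
    have hpath := hE.reflTransGen S (by omega) u (hF u) v (hF v) hu hv
    induction hpath with
    | refl => rfl
    | @tail b c _ hbc ih =>
      refine (ih hbc.2.1).trans ?_
      by_cases h : b = c
      · subst h
        rfl
      · exact SimpleGraph.Adj.reachable (G := Δ.induce _) ⟨h, hbc.1⟩
end

section
/- Let k ≥ 2 and L ≥ 2 be integers, and let h ∈ F_k be a cyclically reduced element containing every reduced word of length L as a subword. Suppose there are groups A, B, C, injective homomorphisms i_A : C → A and i_B : C → B with i_A(C) ≠ A and i_B(C) ≠ B, and an isomorphism Φ from F_k to the amalgamated free product A *_C B (the pushout of i_A and i_B), such that C is a free group of rank r and Φ(h) lies in a conjugate of the canonical image of A or of the canonical image of B in A *_C B. Then r > (k−1)(L−2). -/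
section Amalgam

/-- `IsAlternating P C i j g` says that `g` is a nonempty product of elements taken alternately from
`P false \ C` and `P true \ C`, the first factor coming from `P i` and the last from `P j`. -/
inductive IsAlternating {G : Type*} [Group G] (P : Bool → Subgroup G) (C : Subgroup G) :
    Bool → Bool → G → Prop
  | single {i : Bool} {x : G} (hx : x ∈ P i) (hxC : x ∉ C) : IsAlternating P C i i x
  | cons {i j : Bool} {x g : G} (hx : x ∈ P i) (hxC : x ∉ C) (hg : IsAlternating P C (!i) j g) :
      IsAlternating P C i j (x * g)

namespace IsAlternating

variable {G : Type*} [Group G] {P : Bool → Subgroup G} {C : Subgroup G} {i j : Bool} {g x : G}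

lemma base_mul (hCP : ∀ i, C ≤ P i) (hx : x ∈ C) (hg : IsAlternating P C i j g) :
    IsAlternating P C i j (x * g) := by
  cases hg with
  | single hy hyC => exact single (mul_mem (hCP _ hx) hy) (by rwa [C.mul_mem_cancel_left hx])
  | cons hy hyC hg =>
    rw [← mul_assoc]
    exact cons (mul_mem (hCP _ hx) hy) (by rwa [C.mul_mem_cancel_left hx]) hg

lemma mul_base (hCP : ∀ i, C ≤ P i) (hg : IsAlternating P C i j g) (hx : x ∈ C) :
    IsAlternating P C i j (g * x) := by
  induction hg with
  | single hy hyC => exact single (mul_mem hy (hCP _ hx)) (by rwa [C.mul_mem_cancel_right hx])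
  | cons hy hyC _ ih => rw [mul_assoc]; exact cons hy hyC ih

lemma snoc (hg : IsAlternating P C i j g) (hx : x ∈ P (!j)) (hxC : x ∉ C) :
    IsAlternating P C i (!j) (g * x) := by
  induction hg with
  | single hy hyC => exact cons hy hyC (single hx hxC)
  | cons hy hyC _ ih => rw [mul_assoc]; exact cons hy hyC (ih hx)

lemma mul_pow {y : G} (hg : IsAlternating P C i j g) (hx : x ∈ P (!j)) (hxC : x ∉ C)
    (hy : y ∈ P j) (hyC : y ∉ C) (n : ℕ) : IsAlternating P C i j (g * (x * y) ^ n) := by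
  induction n with
  | zero => simpa using hg
  | succ n ih =>
    rw [pow_succ, ← mul_assoc, ← mul_assoc]
    simpa using (ih.snoc hx hxC).snoc (x := y) (by simpa using hy) hyC

lemma pow_succ {y : G} (hx : x ∈ P (!j)) (hxC : x ∉ C)
    (hy : y ∈ P j) (hyC : y ∉ C) (n : ℕ) : IsAlternating P C (!j) j ((x * y) ^ (n + 1)) := by
  rw [_root_.pow_succ']
  exact (cons hx hxC (single (by simpa using hy) hyC : IsAlternating P C (!!j) (!!j) y)
    |> fun h => by simpa using h.mul_pow (by simpa using hx) hxC (by simpa using hy) hyC n)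

/-- Left multiplication by an element of a factor preserves alternating products, unless
it collapses them into that factor. -/
lemma factor_mul (hCP : ∀ i, C ≤ P i) {l : Bool} (hx : x ∈ P l) (hg : IsAlternating P C i j g) :
    (∃ i', IsAlternating P C i' j (x * g)) ∨ (x * g ∈ C ∧ j = l) := by
  by_cases hxC : x ∈ C
  · exact Or.inl ⟨_, hg.base_mul hCP hxC⟩
  by_cases hil : i = l
  · subst hil
    cases hg with
    | single hy hyC =>
      by_cases hxy : x * g ∈ C
      · exact Or.inr ⟨hxy, rfl⟩
      · exact Or.inl ⟨_, single (mul_mem hx hy) hxy⟩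
    | @cons _ _ y g hy hyC hg =>
      rw [← mul_assoc]
      by_cases hxy : x * y ∈ C
      · exact Or.inl ⟨_, hg.base_mul hCP hxy⟩
      · exact Or.inl ⟨_, cons (mul_mem hx hy) hxy hg⟩
  · exact Or.inl ⟨l, cons hx hxC (by rwa [← Bool.eq_not_of_ne hil])⟩

end IsAlternating

/-- Internal form of a nontrivial amalgamated product decomposition `G = P false *_C P true`. -/
structure IsAmalgam {G : Type*} [Group G] (P : Bool → Subgroup G) (C : Subgroup G) : Prop where
  le : ∀ i, C ≤ P i
  exists_not_mem : ∀ i, ∃ x ∈ P i, x ∉ C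
  closure : Subgroup.closure {x : G | ∃ i, x ∈ P i} = ⊤
  not_mem : ∀ {i j g}, IsAlternating P C i j g → g ∉ C

namespace IsAmalgam

open Pointwise

variable {G : Type*} [Group G] {P : Bool → Subgroup G} {C : Subgroup G}

/-- The edges of the Bass-Serre tree on one side of the base edge: the cosets of elements
whose alternating expression ends in `P true`. -/
def halfTree (P : Bool → Subgroup G) (C : Subgroup G) : Set (G ⧸ C) :=
  {s | ∃ (i : Bool) (g : G), IsAlternating P C i true g ∧ (g : G ⧸ C) = s}

lemma mk_mem_halfTree (h : IsAmalgam P C) {g : G} :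
    (g : G ⧸ C) ∈ halfTree P C ↔ ∃ i, IsAlternating P C i true g := by
  constructor
  · rintro ⟨i, g', hg', he⟩
    refine ⟨i, ?_⟩
    rw [QuotientGroup.eq] at he
    simpa using hg'.mul_base h.le he
  · rintro ⟨i, hg⟩
    exact ⟨i, g, hg, rfl⟩

lemma smul_mem_halfTree (h : IsAmalgam P C) {x : G} (hx : x ∈ P false) {s : G ⧸ C} :
    x • s ∈ halfTree P C ↔ s ∈ halfTree P C := by
  have key : ∀ x ∈ P false, ∀ s ∈ halfTree P C, x • s ∈ halfTree P C := by
    rintro x hx _ ⟨i, g, hg, rfl⟩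
    rcases hg.factor_mul h.le hx with ⟨i', h'⟩ | ⟨-, h'⟩
    · exact ⟨i', _, h', rfl⟩
    · simp at h'
  refine ⟨fun hs => ?_, key x hx s⟩
  simpa using key _ (inv_mem hx) _ hs

lemma smul_mem_insert_halfTree (h : IsAmalgam P C) {x : G} (hx : x ∈ P true) {s : G ⧸ C} :
    x • s ∈ insert ((1 : G) : G ⧸ C) (halfTree P C) ↔
      s ∈ insert ((1 : G) : G ⧸ C) (halfTree P C) := by
  have key : ∀ x ∈ P true, ∀ s ∈ insert ((1 : G) : G ⧸ C) (halfTree P C),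
      x • s ∈ insert ((1 : G) : G ⧸ C) (halfTree P C) := by
    rintro x hx _ (rfl | ⟨i, g, hg, rfl⟩)
    · by_cases hxC : x ∈ C
      · left
        rw [MulAction.Quotient.smul_coe, eq_comm, QuotientGroup.eq]
        simpa using hxC
      · exact Or.inr ⟨true, x, .single hx hxC, by simp⟩
    · rcases hg.factor_mul h.le hx with ⟨i', h'⟩ | ⟨h', -⟩
      · exact Or.inr ⟨i', _, h', rfl⟩
      · left
        rw [MulAction.Quotient.smul_coe, eq_comm, QuotientGroup.eq]
        simpa using h'
  refine ⟨fun hs => ?_, key x hx s⟩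
  simpa using key _ (inv_mem hx) _ hs

lemma finite_coboundary (h : IsAmalgam P C) (x : G) :
    {s : G ⧸ C | ¬(s ∈ halfTree P C ↔ x • s ∈ halfTree P C)}.Finite := by
  have hx : x ∈ Subgroup.closure {x : G | ∃ i, x ∈ P i} := by rw [h.closure]; trivial
  induction hx using Subgroup.closure_induction with
  | mem x hx =>
    obtain ⟨_ | _, hx⟩ := hx
    · convert Set.finite_empty
      ext s
      simp [h.smul_mem_halfTree hx]
    · refine (Set.toFinite {((1 : G) : G ⧸ C), x⁻¹ • ((1 : G) : G ⧸ C)}).subset fun s hs => ?_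
      by_contra hcon
      simp only [Set.mem_insert_iff, Set.mem_singleton_iff, not_or, eq_inv_smul_iff] at hcon
      have := h.smul_mem_insert_halfTree hx (s := s)
      simp only [Set.mem_insert_iff, hcon, false_or] at this
      exact hs this.symm
  | one => simp
  | mul a b _ _ iha ihb =>
    refine (ihb.union (iha.preimage (MulAction.injective b).injOn)).subset fun s hs => ?_
    by_contra hcon
    simp only [Set.mem_union, Set.mem_ofPred_eq, Set.mem_preimage, not_or, not_not] at hcon
    exact hs (by rw [mul_smul]; exact hcon.1.trans hcon.2)
  | inv a _ ih =>
    refine (ih.preimage (MulAction.injective a⁻¹).injOn).subset fun s hs => ?_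
    simpa [iff_comm] using hs

lemma infinite_of_pow_mem {x : G} {Y : Set (G ⧸ C)} (hx : ∀ n : ℕ, x ^ (n + 1) ∉ C)
    (hY : ∀ n : ℕ, ((x ^ (n + 1) : G) : G ⧸ C) ∈ Y) : Y.Infinite := by
  refine Set.infinite_of_injective_forall_mem (f := fun n : ℕ => ((x ^ (n + 1) : G) : G ⧸ C))
    ?_ hY
  have key : ∀ m d : ℕ, ((x ^ (m + 1) : G) : G ⧸ C) ≠ ((x ^ (m + (d + 1) + 1) : G) : G ⧸ C) := by
    intro m d he
    rw [QuotientGroup.eq] at he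
    refine hx d ?_
    convert he using 1
    rw [eq_inv_mul_iff_mul_eq, ← pow_add]
    congr 1
    omega
  intro m n hmn
  rcases lt_trichotomy m n with hlt | rfl | hlt
  · obtain ⟨d, rfl⟩ := Nat.exists_eq_add_of_lt hlt
    exact absurd hmn (key m d)
  · rfl
  · obtain ⟨d, rfl⟩ := Nat.exists_eq_add_of_lt hlt
    exact absurd hmn.symm (key n d)

lemma infinite_halfTree (h : IsAmalgam P C) : (halfTree P C).Infinite := by
  obtain ⟨a, ha, haC⟩ := h.exists_not_mem false
  obtain ⟨b, hb, hbC⟩ := h.exists_not_mem true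
  have hab : ∀ n : ℕ, IsAlternating P C false true ((a * b) ^ (n + 1)) :=
    IsAlternating.pow_succ (j := true) ha haC hb hbC
  exact infinite_of_pow_mem (fun n => h.not_mem (hab n)) fun n => ⟨_, _, hab n, rfl⟩

lemma infinite_compl_halfTree (h : IsAmalgam P C) : (halfTree P C)ᶜ.Infinite := by
  obtain ⟨a, ha, haC⟩ := h.exists_not_mem false
  obtain ⟨b, hb, hbC⟩ := h.exists_not_mem true
  have hba : ∀ n : ℕ, IsAlternating P C true false ((b * a) ^ (n + 1)) :=
    IsAlternating.pow_succ (j := false) hb hbC ha haC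
  refine infinite_of_pow_mem (fun n => h.not_mem (hba n)) fun n hn => ?_
  obtain ⟨i, hi⟩ := h.mk_mem_halfTree.1 hn
  have h' := hi.mul_pow (inv_mem ha) (by simpa using haC) (inv_mem hb) (by simpa using hbC) (n + 1)
  rw [← mul_inv_rev, inv_pow, mul_inv_cancel] at h'
  exact h.not_mem h' C.one_mem

/-- An orbit of an elliptic element eventually stays on one side of the base edge. -/
lemma exists_eventual_side (h : IsAmalgam P C) {y p : G} {i : Bool} (hy : p * y * p⁻¹ ∈ P i)
    (s : G ⧸ C) (hinj : Function.Injective fun n : ℤ => y ^ n • s) :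
    ∃ c : Prop, {n : ℤ | ¬(y ^ n • s ∈ halfTree P C ↔ c)}.Finite := by
  have hconj : ∀ n : ℤ, (p * y * p⁻¹) ^ n • p • s = p • y ^ n • s := fun n => by
    rw [conj_zpow, mul_smul, mul_smul, inv_smul_smul]
  have hfin : {n : ℤ | ¬(y ^ n • s ∈ halfTree P C ↔ p • y ^ n • s ∈ halfTree P C)}.Finite :=
    (h.finite_coboundary p).preimage hinj.injOn
  cases i
  · refine ⟨p • s ∈ halfTree P C, hfin.subset fun n hn => ?_⟩
    have := h.smul_mem_halfTree (zpow_mem hy n) (s := p • s)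
    rw [hconj] at this
    simpa [this] using hn
  · have hone : {n : ℤ | p • y ^ n • s = ((1 : G) : G ⧸ C)}.Finite :=
      Set.Subsingleton.finite fun m hm n hn =>
        hinj (MulAction.injective p ((hm : _ = _).trans (hn : _ = _).symm))
    refine ⟨p • s ∈ insert ((1 : G) : G ⧸ C) (halfTree P C), (hfin.union hone).subset
      fun n hn => ?_⟩
    by_contra hcon
    simp only [Set.mem_union, Set.mem_ofPred_eq, not_or, not_not] at hcon
    have := h.smul_mem_insert_halfTree (zpow_mem hy n) (s := p • s)
    rw [hconj, Set.mem_insert_iff, or_iff_right hcon.2] at this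
    exact hn (hcon.1.trans this)

lemma comap {G' : Type*} [Group G'] (e : G' ≃* G) (h : IsAmalgam P C) :
    IsAmalgam (fun i => (P i).comap e.toMonoidHom) (C.comap e.toMonoidHom) where
  le i := Subgroup.comap_mono (h.le i)
  exists_not_mem i := by
    obtain ⟨x, hx, hxC⟩ := h.exists_not_mem i
    exact ⟨e.symm x, by simpa using hx, by simpa using hxC⟩
  closure := by
    have := congrArg (Subgroup.map e.symm.toMonoidHom) h.closure
    rw [MonoidHom.map_closure, Subgroup.map_top_of_surjective _ e.symm.surjective] at this
    rw [← this]
    congr 1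
    ext x
    constructor
    · rintro ⟨i, hi⟩
      exact ⟨e x, ⟨i, hi⟩, by simp⟩
    · rintro ⟨y, ⟨i, hi⟩, rfl⟩
      exact ⟨i, by simpa using hi⟩
  not_mem {i j g} hg := by
    have : IsAlternating P C i j (e g) := by
      induction hg with
      | single hx hxC => exact .single hx hxC
      | cons hx hxC _ ih => rw [map_mul]; exact .cons hx hxC ih
    exact h.not_mem this

open Monoid in
lemma pushoutI {H : Type*} [Group H] {K : Bool → Type*} [∀ i, Group (K i)]
    {φ : ∀ i, H →* K i} (hφ : ∀ i, Function.Injective (φ i)) (hφ' : ∀ i, (φ i).range ≠ ⊤) :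
    IsAmalgam (fun i => (PushoutI.of (φ := φ) i).range) (PushoutI.base φ).range where
  le i := by
    rintro _ ⟨x, rfl⟩
    exact ⟨φ i x, PushoutI.of_apply_eq_base φ i x⟩
  exists_not_mem i := by
    obtain ⟨x, hx⟩ : ∃ x, x ∉ (φ i).range := by
      by_contra! hcon
      exact hφ' i (eq_top_iff.2 fun x _ => hcon x)
    refine ⟨PushoutI.of i x, ⟨x, rfl⟩, ?_⟩
    rintro ⟨y, hy⟩
    rw [← PushoutI.of_apply_eq_base φ i] at hy
    exact hx ⟨y, PushoutI.of_injective hφ i hy⟩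
  closure := by
    refine eq_top_iff.2 fun x _ => ?_
    induction x using PushoutI.induction_on with
    | of i g => exact Subgroup.subset_closure ⟨i, g, rfl⟩
    | base y =>
      rw [← PushoutI.of_apply_eq_base φ true]
      exact Subgroup.subset_closure ⟨true, _, rfl⟩
    | mul x y hx hy => exact mul_mem (hx trivial) (hy trivial)
  not_mem {i j g} hg := by
    classical
    obtain ⟨w, hw, rfl, hi⟩ : ∃ w : CoprodI.Word K, PushoutI.Reduced φ w ∧
        PushoutI.ofCoprodI w.prod = g ∧ w.fstIdx = some i := by
      have hnot : ∀ {i x}, PushoutI.of i x ∉ (PushoutI.base φ).range → x ∉ (φ i).range := by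
        rintro i _ hx ⟨y, rfl⟩
        exact hx ⟨y, (PushoutI.of_apply_eq_base φ i y).symm⟩
      have hne : ∀ {i x}, x ∉ (φ i).range → x ≠ 1 := by
        rintro i _ hx rfl
        exact hx (one_mem _)
      induction hg with
      | @single i _ hx hxC =>
        obtain ⟨x, rfl⟩ := hx
        refine ⟨CoprodI.Word.cons x .empty (by change none ≠ some i; simp) (hne (hnot hxC)),
          ?_, by simp, by simp⟩
        rintro ⟨l, z⟩ hz
        simp only [CoprodI.Word.cons, CoprodI.Word.empty, List.mem_singleton] at hz
        cases hz
        exact hnot hxC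
      | @cons i _ _ g hx hxC hg ih =>
        obtain ⟨x, rfl⟩ := hx
        obtain ⟨w, hw, rfl, hi⟩ := ih
        refine ⟨CoprodI.Word.cons x w (by simp [hi]) (hne (hnot hxC)), ?_, by simp, by simp⟩
        rintro ⟨l, z⟩ hz
        simp only [CoprodI.Word.cons, List.mem_cons] at hz
        rcases hz with hz | hz
        · cases hz
          exact hnot hxC
        · exact hw _ hz
    intro hmem
    rw [hw.eq_empty_of_mem_range hφ hmem] at hi
    simp [CoprodI.Word.fstIdx, CoprodI.Word.empty] at hi

end IsAmalgam

/-- The family of groups with `A` at `false` and `B` at `true`. -/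
abbrev boolFamily (A B : Type) : Bool → Type
  | false => A
  | true => B

instance boolFamilyGroup (A B : Type) [Group A] [Group B] : ∀ i, Group (boolFamily A B i)
  | false => inferInstanceAs (Group A)
  | true => inferInstanceAs (Group B)

/-- The family of homomorphisms with `f` at `false` and `g` at `true`. -/
def boolHom {A B C : Type} [Group A] [Group B] [Group C] (f : C →* A) (g : C →* B) :
    ∀ i, C →* boolFamily A B i
  | false => f
  | true => g

open Monoid in
/-- A group with the universal property of a pushout of two proper inclusions is an internal
amalgamated product. -/
lemma isAmalgam_of_universal {A B C G : Type} [Group A] [Group B] [Group C] [Group G]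
    {iA : C →* A} {iB : C →* B} (hiA : Function.Injective iA) (hiB : Function.Injective iB)
    (hrA : iA.range ≠ ⊤) (hrB : iB.range ≠ ⊤) {jA : A →* G} {jB : B →* G}
    (hsq : jA.comp iA = jB.comp iB)
    (hpush : ∀ (K : Type) [Group K], ∀ (fA : A →* K) (fB : B →* K),
      fA.comp iA = fB.comp iB → ∃! f : G →* K, f.comp jA = fA ∧ f.comp jB = fB) :
    IsAmalgam (fun i => match i with | false => jA.range | true => jB.range)
      (jA.comp iA).range := by
  let φ := boolHom iA iB
  have hφ : ∀ i, Function.Injective (φ i)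
    | false => hiA
    | true => hiB
  have hφ' : ∀ i, (φ i).range ≠ ⊤
    | false => hrA
    | true => hrB
  let oA : A →* PushoutI φ := PushoutI.of (φ := φ) false
  let oB : B →* PushoutI φ := PushoutI.of (φ := φ) true
  have hoA : oA.comp iA = PushoutI.base φ := PushoutI.of_comp_eq_base (φ := φ) false
  have hoB : oB.comp iB = PushoutI.base φ := PushoutI.of_comp_eq_base (φ := φ) true
  obtain ⟨f, ⟨hfA, hfB⟩, -⟩ := hpush (PushoutI φ) oA oB (hoA.trans hoB.symm)
  let j : ∀ i, boolFamily A B i →* G := fun i => match i with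
    | false => jA
    | true => jB
  have hj : ∀ i, (j i).comp (φ i) = jA.comp iA
    | false => rfl
    | true => hsq.symm
  let f' : PushoutI φ →* G := PushoutI.lift j (jA.comp iA) hj
  have hf'A : f'.comp oA = jA :=
    MonoidHom.ext fun x =>
      PushoutI.lift_of (φ := φ) (G := boolFamily A B) (i := false) j (jA.comp iA) hj x
  have hf'B : f'.comp oB = jB :=
    MonoidHom.ext fun x =>
      PushoutI.lift_of (φ := φ) (G := boolFamily A B) (i := true) j (jA.comp iA) hj x
  have h₁ : f'.comp f = MonoidHom.id G :=
    (hpush G jA jB hsq).unique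
      ⟨by rw [MonoidHom.comp_assoc, hfA, hf'A], by rw [MonoidHom.comp_assoc, hfB, hf'B]⟩
      ⟨MonoidHom.id_comp _, MonoidHom.id_comp _⟩
  have h₂ : f.comp f' = MonoidHom.id _ := by
    refine PushoutI.hom_ext_nonempty fun i => ?_
    match i with
    | false =>
      change f.comp (f'.comp oA) = oA
      rw [hf'A, hfA]
    | true =>
      change f.comp (f'.comp oB) = oB
      rw [hf'B, hfB]
  let e : G ≃* PushoutI φ := f.toMulEquiv f' h₁ h₂
  have hcomap : ∀ {D : Type} [Group D] (p : D →* G) (q : D →* PushoutI φ), f.comp p = q →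
      q.range.comap e.toMonoidHom = p.range := by
    rintro D _ p _ rfl
    ext x
    constructor
    · rintro ⟨y, hy⟩
      exact ⟨y, e.injective hy⟩
    · rintro ⟨y, rfl⟩
      exact ⟨y, rfl⟩
  have hbase : f.comp (jA.comp iA) = PushoutI.base φ := by
    rw [← MonoidHom.comp_assoc, hfA, hoA]
  have := (IsAmalgam.pushoutI hφ hφ').comap e
  rw [hcomap _ _ hbase] at this
  convert this using 1
  funext i
  match i with
  | false => exact (hcomap _ _ hfA).symm
  | true => exact (hcomap _ _ hfB).symm

end Amalgam

section EdgeCount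

variable {k : ℕ} {S M : Type*} [MulAction (FreeGroup (Fin k)) S] [AddCommGroup M]

/-- The action of a free group on `S × M` twisted by a labelling `u` of the Schreier graph. -/
def twistedAction (u : S → Fin k → M) : FreeGroup (Fin k) →* Equiv.Perm (S × M) :=
  FreeGroup.lift fun i =>
    { toFun := fun p => (FreeGroup.of i • p.1, p.2 + u p.1 i)
      invFun := fun q =>
        ((FreeGroup.of i)⁻¹ • q.1, q.2 - u ((FreeGroup.of i)⁻¹ • q.1) i)
      left_inv := fun p => by simp
      right_inv := fun q => by simp }

/-- The sum of the labels along the path from `s` to `g • s` spelled by `g`. -/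
def pathSum (u : S → Fin k → M) (g : FreeGroup (Fin k)) (s : S) : M :=
  (twistedAction u g (s, 0)).2

lemma twistedAction_apply (u : S → Fin k → M) (g : FreeGroup (Fin k)) (s : S) (m : M) :
    twistedAction u g (s, m) = (g • s, m + pathSum u g s) := by
  suffices H : ∀ s, ∃ d, ∀ m, twistedAction u g (s, m) = (g • s, m + d) by
    obtain ⟨d, hd⟩ := H s
    simp [pathSum, hd]
  induction g using FreeGroup.induction_on with
  | C1 => exact fun s => ⟨0, by simp⟩
  | of i => exact fun s => ⟨u s i, by simp [twistedAction]⟩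
  | inv_of i _ =>
    refine fun s => ⟨-u ((FreeGroup.of i)⁻¹ • s) i, fun m => ?_⟩
    rw [map_inv, Equiv.Perm.inv_eq_iff_eq]
    simp [twistedAction]
  | mul g g' hg hg' =>
    intro s
    obtain ⟨d', hd'⟩ := hg' s
    obtain ⟨d, hd⟩ := hg (g' • s)
    exact ⟨d' + d, fun m => by simp [hd', hd, mul_smul, add_assoc]⟩

lemma pathSum_mul (u : S → Fin k → M) (g g' : FreeGroup (Fin k)) (s : S) :
    pathSum u (g * g') s = pathSum u g' s + pathSum u g (g' • s) := by
  rw [pathSum, map_mul, Equiv.Perm.mul_apply, twistedAction_apply, twistedAction_apply, zero_add]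

lemma pathSum_one (u : S → Fin k → M) (s : S) : pathSum u 1 s = 0 := by
  simp [pathSum]

lemma pathSum_of (u : S → Fin k → M) (i : Fin k) (s : S) :
    pathSum u (FreeGroup.of i) s = u s i := by
  simp [pathSum, twistedAction]

/-- Label sums over loops at `o` lie in any subgroup containing the sums over
a generating set of loops. -/
lemma pathSum_mem_of_mem_closure (u : S → Fin k → M) {o : S} {T : Set (FreeGroup (Fin k))}
    (hT : MulAction.stabilizer (FreeGroup (Fin k)) o = Subgroup.closure T)
    {N : AddSubgroup M} (hN : ∀ g ∈ T, pathSum u g o ∈ N) {g : FreeGroup (Fin k)}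
    (hg : g • o = o) : pathSum u g o ∈ N := by
  have hcl : ∀ g ∈ Subgroup.closure T, g • o = o := fun g hg => by
    rwa [← hT, MulAction.mem_stabilizer_iff] at hg
  have hg' : g ∈ Subgroup.closure T := by rwa [← hT, MulAction.mem_stabilizer_iff]
  induction hg' using Subgroup.closure_induction with
  | mem g hgT => exact hN g hgT
  | one => rw [pathSum_one]; exact N.zero_mem
  | mul a b ha hb iha ihb =>
    rw [pathSum_mul, hcl b hb]
    exact N.add_mem (ihb (hcl b hb)) (iha (hcl a ha))
  | inv a ha iha =>
    have h := pathSum_mul u a⁻¹ a o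
    rw [inv_mul_cancel, pathSum_one, hcl a ha] at h
    rw [eq_neg_of_add_eq_zero_right h.symm]
    exact N.neg_mem (iha (hcl a ha))

/-- The edges of the Schreier graph of `S` with both endpoints in `V`. -/
def inducedEdges [DecidableEq S] (V : Finset S) : Finset (S × Fin k) :=
  (V ×ˢ Finset.univ).filter fun p => FreeGroup.of p.2 • p.1 ∈ V

lemma card_inducedEdges_lt [DecidableEq S] {r : ℕ} {V : Finset S} (hV : V.Nonempty)
    (htrans : ∀ s t : S, ∃ g : FreeGroup (Fin k), g • s = t) (o : S)
    (gens : Fin r → FreeGroup (Fin k))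
    (hgens : MulAction.stabilizer (FreeGroup (Fin k)) o = Subgroup.closure (Set.range gens)) :
    (inducedEdges (k := k) V).card < r + V.card := by
  classical
  choose p hp using htrans o
  obtain ⟨v₀, hv₀⟩ := hV
  let M := {e // e ∈ inducedEdges (k := k) V} → ℚ
  let u : S → Fin k → M := fun s i =>
    if h : (s, i) ∈ inducedEdges V then Pi.single ⟨(s, i), h⟩ 1 else 0
  let f : Fin r ⊕ {v // v ∈ V.erase v₀} → M :=
    Sum.elim (fun j => pathSum u (gens j) o)
      (fun v => pathSum u (p v) o - pathSum u (p v₀) o)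
  let N := Submodule.span ℚ (Set.range f)
  have hgen : ∀ j, pathSum u (gens j) o ∈ N := fun j =>
    Submodule.subset_span ⟨Sum.inl j, rfl⟩
  have hver : ∀ v ∈ V, pathSum u (p v) o - pathSum u (p v₀) o ∈ N := by
    intro v hv
    by_cases h : v = v₀
    · rw [h, sub_self]; exact N.zero_mem
    · exact Submodule.subset_span ⟨Sum.inr ⟨v, Finset.mem_erase.2 ⟨h, hv⟩⟩, rfl⟩
  have hloop : ∀ g : FreeGroup (Fin k), g • o = o → pathSum u g o ∈ N := fun g hg =>
    pathSum_mem_of_mem_closure u hgens (N := N.toAddSubgroup)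
      (by rintro _ ⟨j, rfl⟩; exact hgen j) hg
  have hedge : ∀ e : {e // e ∈ inducedEdges (k := k) V}, Pi.single e (1 : ℚ) ∈ N := by
    rintro ⟨⟨v, i⟩, he⟩
    obtain ⟨hv, hv'⟩ : v ∈ V ∧ FreeGroup.of i • v ∈ V := by simpa [inducedEdges] using he
    set v' := FreeGroup.of i • v with hv'_def
    have h₁ : pathSum u (FreeGroup.of i * p v) o = pathSum u (p v) o + u v i := by
      rw [pathSum_mul, hp, pathSum_of]
    have hc : ((p v')⁻¹ * (FreeGroup.of i * p v)) • o = o := by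
      rw [mul_smul, mul_smul, hp, inv_smul_eq_iff, hp]
    have h₂ := pathSum_mul u (p v') ((p v')⁻¹ * (FreeGroup.of i * p v)) o
    rw [mul_inv_cancel_left, hc, h₁] at h₂
    have h₃ : u v i = pathSum u ((p v')⁻¹ * (FreeGroup.of i * p v)) o +
        ((pathSum u (p v') o - pathSum u (p v₀) o) -
          (pathSum u (p v) o - pathSum u (p v₀) o)) := by
      rw [← sub_eq_iff_eq_add'.2 h₂]; abel
    have h₄ : u v i = Pi.single ⟨(v, i), he⟩ 1 := dif_pos he
    rw [← h₄, h₃]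
    exact N.add_mem (hloop _ hc) (N.sub_mem (hver _ hv') (hver _ hv))
  have htop : N = ⊤ := by
    rw [eq_top_iff, ← (Pi.basisFun ℚ _).span_eq, Submodule.span_le]
    rintro _ ⟨e, rfl⟩
    simpa using hedge e
  have hle := finrank_range_le_card (R := ℚ) f
  have hfin : Set.finrank ℚ (Set.range f) = (inducedEdges (k := k) V).card := by
    change Module.finrank ℚ N = _
    rw [htop, finrank_top, Module.finrank_pi, Fintype.card_coe]
  rw [hfin, Fintype.card_sum, Fintype.card_fin, Fintype.card_coe, Finset.card_erase_of_mem hv₀]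
    at hle
  have := Finset.card_pos.2 ⟨v₀, hv₀⟩
  omega

end EdgeCount

section SchreierGraph

variable {k : ℕ} {S : Type*} [MulAction (FreeGroup (Fin k)) S]

open FreeGroup (mk IsReduced invRev)

/-- The formal inverse of a letter. -/
abbrev letterInv (x : Fin k × Bool) : Fin k × Bool := (x.1, !x.2)

lemma mk_append_smul (w₁ w₂ : List (Fin k × Bool)) (s : S) :
    mk (w₁ ++ w₂) • s = mk w₁ • mk w₂ • s := by
  rw [← FreeGroup.mul_mk, mul_smul]

lemma mk_cons_smul (x : Fin k × Bool) (w : List (Fin k × Bool)) (s : S) :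
    mk (x :: w) • s = mk [x] • mk w • s :=
  mk_append_smul [x] w s

lemma mk_nil_smul (s : S) : mk ([] : List (Fin k × Bool)) • s = s := by
  rw [← FreeGroup.one_eq_mk, one_smul]

lemma mk_letterInv_smul (x : Fin k × Bool) (s : S) : mk [letterInv x] • mk [x] • s = s := by
  rw [show mk [letterInv x] = (mk [x])⁻¹ by simp [FreeGroup.inv_mk, invRev], inv_smul_smul]

lemma mk_smul_eq_iff (x : Fin k × Bool) (s t : S) :
    mk [x] • s = t ↔ mk [letterInv x] • t = s := by
  rw [show mk [letterInv x] = (mk [x])⁻¹ by simp [FreeGroup.inv_mk, invRev],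
    inv_smul_eq_iff, eq_comm]

lemma FreeGroup.IsReduced.of_isInfix {u w : List (Fin k × Bool)} (hw : IsReduced w)
    (hu : u <:+: w) : IsReduced u := by
  obtain ⟨p, q, rfl⟩ := hu
  exact (List.isChain_append.1 (List.isChain_append.1 hw).1).2.1

lemma FreeGroup.IsReduced.invRev_word {w : List (Fin k × Bool)} (hw : IsReduced w) :
    IsReduced (invRev w) := by
  rw [FreeGroup.isReduced_iff_reduce_eq] at hw ⊢
  rw [FreeGroup.reduce_invRev, hw]

lemma isReduced_cons_cons_iff_s10 {x y : Fin k × Bool} {w : List (Fin k × Bool)} :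
    IsReduced (x :: y :: w) ↔ x ≠ letterInv y ∧ IsReduced (y :: w) := by
  rw [FreeGroup.isReduced_cons_cons]
  refine and_congr_left fun _ => ?_
  obtain ⟨a, b⟩ := x
  obtain ⟨c, d⟩ := y
  cases b <;> cases d <;> simp

/-- The path in the Schreier graph that starts at `u` and spells `w` (read from the right)
stays in `D`. -/
def PathIn (D : Set S) (u : S) (w : List (Fin k × Bool)) : Prop :=
  ∀ t, t <:+ w → mk t • u ∈ D

lemma pathIn_append {D : Set S} {u : S} {w₁ w₂ : List (Fin k × Bool)} :
    PathIn D u (w₁ ++ w₂) ↔ PathIn D u w₂ ∧ PathIn D (mk w₂ • u) w₁ := by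
  constructor
  · refine fun h => ⟨fun t ht => h t (ht.trans (List.suffix_append _ _)), fun t ht => ?_⟩
    rw [← mk_append_smul]
    obtain ⟨p, rfl⟩ := ht
    exact h _ ⟨p, by simp⟩
  · rintro ⟨h₂, h₁⟩ t ⟨p, hp⟩
    rcases List.append_eq_append_iff.1 hp with ⟨a, rfl, rfl⟩ | ⟨a, rfl, rfl⟩
    · rw [mk_append_smul]
      exact h₁ _ ⟨p, rfl⟩
    · exact h₂ _ ⟨a, rfl⟩

lemma pathIn_singleton {D : Set S} {u : S} {x : Fin k × Bool} :
    PathIn D u [x] ↔ u ∈ D ∧ mk [x] • u ∈ D := by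
  simp [PathIn, List.suffix_cons_iff, mk_nil_smul, and_comm]

lemma PathIn.mk_smul_mem {D : Set S} {u : S} {w : List (Fin k × Bool)} (h : PathIn D u w) :
    mk w • u ∈ D :=
  h w (List.suffix_refl w)

lemma PathIn.inverse {D : Set S} {u : S} {w : List (Fin k × Bool)} (h : PathIn D u w) :
    PathIn D (mk w • u) (invRev w) := by
  induction w with
  | nil => simpa [mk_nil_smul] using h
  | cons x w ih =>
    obtain ⟨hw, hx⟩ := pathIn_append (w₁ := [x]).1 h
    rw [FreeGroup.invRev_cons, pathIn_append, mk_cons_smul]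
    rw [show invRev [x] = [letterInv x] by simp [FreeGroup.invRev],
      mk_letterInv_smul, pathIn_singleton, mk_letterInv_smul]
    rw [pathIn_singleton] at hx
    exact ⟨⟨hx.2, hx.1⟩, ih hw⟩

lemma PathIn.red {D : Set S} {u : S} {w w' : List (Fin k × Bool)} (h : PathIn D u w)
    (hred : FreeGroup.Red w w') : PathIn D u w' := by
  induction hred with
  | refl => exact h
  | tail _ hstep ih =>
    cases hstep with
    | @not L₁ L₂ x b =>
      rw [show L₁ ++ (x, b) :: (x, !b) :: L₂ = L₁ ++ ([(x, b)] ++ ([(x, !b)] ++ L₂)) by simp,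
        pathIn_append, pathIn_append, pathIn_append, mk_append_smul, mk_append_smul,
        mk_append_smul] at ih
      have hcan : mk [(x, b)] • mk [(x, !b)] • mk L₂ • u = mk L₂ • u := by
        have := mk_letterInv_smul (x, !b) (mk L₂ • u)
        rwa [letterInv, Bool.not_not] at this
      rw [hcan] at ih
      exact pathIn_append.2 ⟨ih.1.1.1, ih.2⟩

variable (k) in
/-- A set of vertices of the Schreier graph is convex if it contains every reduced path
between any two of its elements. -/
def PathConvex (V : Set S) : Prop :=
  ∀ v ∈ V, ∀ w : List (Fin k × Bool), IsReduced w → mk w • v ∈ V → PathIn V v w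

/-- If a point stabilizer is finitely generated, then every finite set of vertices is contained
in a finite convex one. -/
lemma exists_finset_pathConvex [DecidableEq S]
    (htrans : ∀ s t : S, ∃ g : FreeGroup (Fin k), g • s = t) (o : S)
    {T : Set (FreeGroup (Fin k))} (hTfin : T.Finite)
    (hT : MulAction.stabilizer (FreeGroup (Fin k)) o = Subgroup.closure T)
    {F : Set S} (hF : F.Finite) :
    ∃ V : Finset S, F ⊆ V ∧ PathConvex k (V : Set S) := by
  choose p hp using htrans o
  let W : Set (List (Fin k × Bool)) :=
    {[]} ∪ FreeGroup.toWord '' T ∪ (fun s => (p s).toWord) '' F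
  have hW : W.Finite := ((Set.finite_singleton _).union (hTfin.image _)).union (hF.image _)
  let D : Set S := ⋃ w ∈ W, (fun t => mk t • o) '' {t | t <:+ w}
  have hD : D.Finite := hW.biUnion fun w _ => by
    refine Set.Finite.image _ ?_
    exact (List.finite_toSet w.tails).subset fun t ht => (List.mem_tails t w).2 ht
  have hWD : ∀ w ∈ W, PathIn D o w := fun w hw t ht =>
    Set.mem_biUnion hw ⟨t, ht, rfl⟩
  have hloop : ∀ g ∈ Subgroup.closure T, ∃ w, mk w = g ∧ PathIn D o w := by
    have hcl : ∀ g ∈ Subgroup.closure T, g • o = o := fun g hg => by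
      rwa [← hT, MulAction.mem_stabilizer_iff] at hg
    intro g hg
    induction hg using Subgroup.closure_induction with
    | mem g hg =>
      exact ⟨g.toWord, FreeGroup.mk_toWord, hWD _ (Or.inl (Or.inr ⟨g, hg, rfl⟩))⟩
    | one => exact ⟨[], rfl, hWD _ (Or.inl (Or.inl rfl))⟩
    | mul a b _ hb iha ihb =>
      obtain ⟨w, rfl, hw⟩ := iha
      obtain ⟨w', rfl, hw'⟩ := ihb
      refine ⟨w ++ w', FreeGroup.mul_mk.symm, pathIn_append.2 ⟨hw', ?_⟩⟩
      rwa [hcl _ hb]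
    | inv a ha iha =>
      obtain ⟨w, rfl, hw⟩ := iha
      refine ⟨invRev w, FreeGroup.inv_mk.symm, ?_⟩
      have := hw.inverse
      rwa [hcl _ ha] at this
  have hreach : ∀ s ∈ D, ∃ t : List (Fin k × Bool), PathIn D o t ∧ mk t • o = s := by
    intro s hs
    obtain ⟨w, hw, t, ⟨q, rfl⟩, rfl⟩ := Set.mem_iUnion₂.1 hs
    exact ⟨t, (pathIn_append.1 (hWD _ hw)).1, rfl⟩
  refine ⟨hD.toFinset, fun s hs => ?_, ?_⟩
  · rw [Set.Finite.coe_toFinset]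
    have := (hWD _ (Or.inr ⟨s, hs, rfl⟩)).mk_smul_mem
    rwa [FreeGroup.mk_toWord, hp] at this
  · rw [Set.Finite.coe_toFinset]
    intro v hv w hw hwv
    obtain ⟨t, ht, rfl⟩ := hreach v hv
    obtain ⟨t', ht', htt'⟩ := hreach _ hwv
    have hstab : (mk t')⁻¹ * mk w * mk t ∈ Subgroup.closure T := by
      rw [← hT, MulAction.mem_stabilizer_iff, mul_smul, mul_smul, inv_smul_eq_iff, htt']
    obtain ⟨c, hc, hcD⟩ := hloop _ hstab
    have hco : mk c • o = o := by
      rw [hc, mul_smul, mul_smul, inv_smul_eq_iff, htt']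
    have hback : mk (invRev t) • mk t • o = o := by
      rw [← FreeGroup.inv_mk, inv_smul_smul]
    have hpath : PathIn D (mk t • o) (t' ++ (c ++ invRev t)) := by
      rw [pathIn_append, pathIn_append, mk_append_smul, hback, hco]
      exact ⟨⟨ht.inverse, hcD⟩, ht'⟩
    have hmk : mk (t' ++ (c ++ invRev t)) = mk w := by
      rw [← FreeGroup.mul_mk, ← FreeGroup.mul_mk, hc, ← FreeGroup.inv_mk]
      group
    have := hpath.red FreeGroup.reduce.red
    rwa [FreeGroup.reduce.sound hmk, hw.reduce_eq] at this

/-- The vertices reached by reduced paths from `v` whose first letter is `x`. -/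
def cone (v : S) (x : Fin k × Bool) : Set S :=
  {s | ∃ w, IsReduced (w ++ [x]) ∧ mk (w ++ [x]) • v = s}

/-- All but finitely many vertices of the cone at `(v, x)` lie on the side `c` of `Y`. -/
def ConeSide (Y : Set S) (c : Prop) (v : S) (x : Fin k × Bool) : Prop :=
  {s | s ∈ cone v x ∧ ¬(s ∈ Y ↔ c)}.Finite

lemma mk_flatten_replicate (w : List (Fin k × Bool)) (n : ℕ) :
    mk (List.replicate n w).flatten = mk w ^ n := by
  induction n with
  | zero => rfl
  | succ n ih => rw [List.replicate_succ, List.flatten_cons, ← FreeGroup.mul_mk, ih, pow_succ']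

lemma injective_zpow_smul {G : Type*} [Group G] [MulAction G S] {g : G} {s : S}
    (h : ∀ n : ℕ, g ^ (n + 1) • s ≠ s) : Function.Injective fun n : ℤ => g ^ n • s := by
  have key : ∀ (m : ℤ) (d : ℕ), g ^ m • s ≠ g ^ (m + d + 1) • s := by
    intro m d he
    rw [add_assoc, zpow_add, mul_smul] at he
    exact h d (by exact_mod_cast (MulAction.injective _ he).symm)
  intro m n hmn
  rcases lt_trichotomy m n with hlt | rfl | hlt
  · obtain ⟨d, rfl⟩ := Int.lt.dest hlt
    exact absurd hmn (by simpa [add_assoc] using key m d)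
  · rfl
  · obtain ⟨d, rfl⟩ := Int.lt.dest hlt
    exact absurd hmn.symm (by simpa [add_assoc] using key n d)

/-- Two cones joined by a line spelling powers of `h` lie on the same side of `Y`. -/
lemma ConeSide.iff_of_subword {h : List (Fin k × Bool)} (hcyc : FreeGroup.IsCyclicallyReduced h)
    {Y : Set S}
    (hline : ∀ s : S, (Function.Injective fun n : ℤ => mk h ^ n • s) →
      ∃ c : Prop, {n : ℤ | ¬(mk h ^ n • s ∈ Y ↔ c)}.Finite)
    {V : Set S} (hV : PathConvex k V) {v v' : S} {x x' : Fin k × Bool} {w : List (Fin k × Bool)}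
    (hv : v ∈ V) (hv' : v' ∈ V) (hx' : mk [x'] • v' ∉ V)
    (hw : mk w • v = v') (hinf : x' :: (w ++ [letterInv x]) <:+: h) {c c' : Prop}
    (hc : ConeSide Y c v x) (hc' : ConeSide Y c' v' x') : c ↔ c' := by
  obtain ⟨p, q, hpq⟩ := hinf
  let R : ℕ → List (Fin k × Bool) := fun n => (List.replicate n h).flatten
  have hR : ∀ n, IsReduced (R n) := fun n => (hcyc.flatten_replicate n).isReduced
  have hRmk : ∀ n, mk (R n) = mk h ^ n := mk_flatten_replicate h
  have hRsucc : ∀ n, R (n + 1) = h ++ R n := fun n => by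
    simp [R, List.replicate_succ]
  have hRsucc' : ∀ n, R (n + 1) = R n ++ h := fun n => by
    simp [R, List.replicate_succ']
  have hinvx : invRev (letterInv x :: q) = invRev q ++ [x] := by simp [FreeGroup.invRev]
  obtain ⟨s, hs⟩ : ∃ s, s = mk (invRev q ++ [x]) • v := ⟨_, rfl⟩
  have hsv : mk (letterInv x :: q) • s = v := by
    rw [hs, ← hinvx, ← FreeGroup.inv_mk, smul_inv_smul]
  have hv'_eq : v' = mk (w ++ letterInv x :: q) • s := by rw [mk_append_smul, hsv, hw]
  have hfwd : ∀ n : ℕ, mk h ^ (n + 1) • s = mk (R n ++ p ++ [x']) • v' := by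
    intro n
    rw [pow_succ, mul_smul, ← hRmk, mk_append_smul, mk_append_smul]
    congr 1
    rw [hv'_eq, ← mk_append_smul, ← mk_append_smul, ← hpq]
    simp
  have hbwd : ∀ n : ℕ, mk h ^ (-(n : ℤ)) • s = mk (invRev (R n) ++ invRev q ++ [x]) • v := by
    intro n
    rw [zpow_neg, zpow_natCast, ← hRmk, FreeGroup.inv_mk, hs, ← mk_append_smul,
      List.append_assoc]
  have hfwd_mem : ∀ n : ℕ, mk h ^ ((n : ℤ) + 1) • s ∈ cone v' x' := fun n => by
    refine ⟨R n ++ p, (hR (n + 1)).of_isInfix ⟨[], w ++ [letterInv x] ++ q, ?_⟩, ?_⟩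
    · rw [hRsucc', ← hpq]; simp
    · rw [← hfwd]; norm_cast
  have hbwd_mem : ∀ n : ℕ, mk h ^ (-(n : ℤ)) • s ∈ cone v x := fun n => by
    refine ⟨invRev (R n) ++ invRev q, ?_, (hbwd n).symm⟩
    rw [List.append_assoc, ← hinvx, ← FreeGroup.invRev_append]
    refine ((hR (n + 1)).of_isInfix ⟨p ++ x' :: w, [], ?_⟩).invRev_word
    rw [hRsucc, ← hpq]; simp
  have hinj : Function.Injective fun n : ℤ => mk h ^ n • s := by
    refine injective_zpow_smul fun n hn => ?_
    rw [hfwd] at hn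
    have hmem : mk (letterInv x :: q ++ (R n ++ p) ++ [x']) • v' ∈ V := by
      rw [List.append_assoc, List.append_assoc, mk_append_smul,
        ← List.append_assoc (R n), hn, hsv]
      exact hv
    have hred : IsReduced (letterInv x :: q ++ (R n ++ p) ++ [x']) := by
      refine (hR (n + 1 + 1)).of_isInfix ⟨p ++ x' :: w, w ++ [letterInv x] ++ q, ?_⟩
      rw [hRsucc, hRsucc']
      conv_rhs => rw [← hpq]
      simp
    exact hx' (hV v' hv' _ hred hmem [x'] (List.suffix_append _ _))
  obtain ⟨d, hd⟩ := hline s hinj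
  have side : ∀ {e : Prop} {u : S} {y : Fin k × Bool} {f : ℕ → ℤ}, Function.Injective f →
      (∀ n, mk h ^ f n • s ∈ cone u y) → ConeSide Y e u y → (e ↔ d) := by
    intro e u y f hf hmem he
    have h₁ := hd.preimage hf.injOn
    have h₂ := Set.Finite.preimage (hinj.comp hf).injOn he
    obtain ⟨n, hn⟩ := (h₁.union h₂).infinite_compl.nonempty
    have hn₁ : mk h ^ f n • s ∈ Y ↔ d := by
      by_contra hcon; exact hn (Or.inl hcon)
    have hn₂ : mk h ^ f n • s ∈ Y ↔ e := by
      by_contra hcon; exact hn (Or.inr ⟨hmem n, hcon⟩)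
    exact hn₂.symm.trans hn₁
  exact (side (f := fun n => -(n : ℤ)) (fun a b hab => by simpa using hab) hbwd_mem hc).trans
    (side (f := fun n => (n : ℤ) + 1) (fun a b hab => by simpa using hab) hfwd_mem hc').symm

/-- Cones joined by a path of length less than `L - 1` lie on the same side of `Y`. -/
def GluesCones (k L : ℕ) {S : Type*} [MulAction (FreeGroup (Fin k)) S] (Y : Set S) : Prop :=
  ∀ {V : Set S}, PathConvex k V → ∀ {v : S} {x x' : Fin k × Bool} {w : List (Fin k × Bool)},
    v ∈ V → mk w • v ∈ V → mk [x'] • mk w • v ∉ V →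
    IsReduced (x' :: (w ++ [letterInv x])) → w.length + 2 ≤ L →
    ∀ {c c' : Prop}, ConeSide Y c v x → ConeSide Y c' (mk w • v) x' → (c ↔ c')

/-- A finite convex set of vertices such that each cone at its boundary essentially lies on one
side of `Y`. -/
structure IsAdapted (k : ℕ) {S : Type*} [MulAction (FreeGroup (Fin k)) S] (Y : Set S)
    (V : Finset S) : Prop where
  nonempty : V.Nonempty
  convex : PathConvex k (V : Set S)
  side : ∀ v ∈ V, ∀ x : Fin k × Bool, mk [x] • v ∉ V → ∃ c, ConeSide Y c v x

lemma exists_isAdapted [DecidableEq S]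
    (htrans : ∀ s t : S, ∃ g : FreeGroup (Fin k), g • s = t) (o : S)
    {T : Set (FreeGroup (Fin k))} (hTfin : T.Finite)
    (hT : MulAction.stabilizer (FreeGroup (Fin k)) o = Subgroup.closure T) {Y : Set S}
    (hY : ∀ g : FreeGroup (Fin k), {s | ¬(s ∈ Y ↔ g • s ∈ Y)}.Finite) :
    ∃ V : Finset S, IsAdapted k Y V := by
  let F : Set S := {o} ∪ ⋃ x : Fin k × Bool, {s | ¬(s ∈ Y ↔ mk [x] • s ∈ Y)}
  have hF : F.Finite := (Set.finite_singleton o).union (Set.finite_iUnion fun x => hY _)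
  obtain ⟨V, hFV, hV⟩ := exists_finset_pathConvex htrans o hTfin hT hF
  refine ⟨V, ⟨o, hFV (Or.inl rfl)⟩, hV, fun v hv x hx => ⟨mk [x] • v ∈ Y, ?_⟩⟩
  have hout : ∀ w, IsReduced (w ++ [x]) → mk (w ++ [x]) • v ∉ V := fun w hw hmem =>
    hx (hV v hv _ hw hmem [x] (List.suffix_append _ _))
  have hsame : ∀ w, IsReduced (w ++ [x]) → (mk (w ++ [x]) • v ∈ Y ↔ mk [x] • v ∈ Y) := by
    intro w hw
    induction w with
    | nil => rfl
    | cons y w ih =>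
      have hw' : IsReduced (w ++ [x]) := hw.of_isInfix ⟨[y], [], by simp⟩
      rw [← ih hw', List.cons_append, mk_cons_smul]
      by_contra hcon
      exact hout w hw' (hFV (Or.inr (Set.mem_iUnion.2 ⟨y, fun h => hcon h.symm⟩)))
  refine Set.finite_empty.subset ?_
  rintro _ ⟨⟨w, hw, rfl⟩, hne⟩
  exact (hne (hsame w hw)).elim

lemma letterInv_ne (x : Fin k × Bool) : x ≠ letterInv x := by
  obtain ⟨a, b⟩ := x
  simp [letterInv]

lemma letterInv_letterInv (x : Fin k × Bool) : letterInv (letterInv x) = x := by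
  simp [letterInv]

/-- Removing a vertex of degree at most one keeps a vertex set adapted. -/
lemma isAdapted_erase [DecidableEq S] {L : ℕ} (hL : 2 ≤ L) {Y : Set S} (hglue : GluesCones k L Y)
    {V : Finset S} (hV : IsAdapted k Y V) {v : S} (hv : v ∈ V) (hne : (V.erase v).Nonempty)
    (hdeg : ∀ y y' : Fin k × Bool, mk [y] • v ∈ V → mk [y'] • v ∈ V → y = y') :
    IsAdapted k Y (V.erase v) where
  nonempty := hne
  convex := by
    intro u hu w hw hwu
    rw [Finset.mem_coe, Finset.mem_erase] at hu hwu
    have hpath := hV.convex u hu.2 w hw hwu.2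
    intro t ht
    rw [Finset.mem_coe, Finset.mem_erase]
    refine ⟨fun htv => ?_, hpath t ht⟩
    match t, ht, htv with
    | [], _, htv => exact hu.1 (by rwa [mk_nil_smul] at htv)
    | a :: t', ht, htv =>
      obtain ⟨p, rfl⟩ := ht
      rcases List.eq_nil_or_concat p with rfl | ⟨p', b, rfl⟩
      · exact hwu.1 htv
      · have h₁ : mk [letterInv a] • v ∈ V := by
          rw [← htv, mk_cons_smul a t', mk_letterInv_smul]
          exact hpath t' ⟨p'.concat b ++ [a], by simp⟩
        have h₂ : mk [b] • v ∈ V := by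
          rw [← htv, ← mk_cons_smul]
          exact hpath (b :: a :: t') ⟨p', by simp⟩
        have hred : IsReduced (b :: a :: t') := hw.of_isInfix ⟨p', [], by simp⟩
        exact (isReduced_cons_cons_iff_s10.1 hred).1 (hdeg _ _ h₂ h₁)
  side := by
    intro u hu x hx
    rw [Finset.mem_erase] at hu
    by_cases hxu : mk [x] • u = v
    · have hback : mk [letterInv x] • v = u := (mk_smul_eq_iff x u v).1 hxu
      have hexit : ∀ y, y ≠ letterInv x → mk [y] • v ∉ V := fun y hy hmem =>
        hy (hdeg _ _ hmem (by rw [hback]; exact hu.2))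
      obtain ⟨c, hc⟩ := hV.side v hv x (hexit x (letterInv_ne x))
      have hall : ∀ y, y ≠ letterInv x → ConeSide Y c v y := by
        intro y hy
        by_cases hyx : y = x
        · rwa [hyx]
        obtain ⟨c', hc'⟩ := hV.side v hv y (hexit y hy)
        have hiff : c ↔ c' := hglue hV.convex (w := []) (x' := y) hv
          (by rwa [mk_nil_smul]) (by rw [mk_nil_smul]; exact hexit y hy)
          (isReduced_cons_cons_iff_s10.2 ⟨by rwa [letterInv_letterInv], .singleton⟩)
          (by simpa using hL) hc (by rwa [mk_nil_smul])
        rwa [propext hiff]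
      refine ⟨c, ((Set.finite_singleton v).union (Set.Finite.biUnion
        (Set.toFinite {y : Fin k × Bool | y ≠ letterInv x}) hall)).subset ?_⟩
      rintro _ ⟨⟨w, hw, rfl⟩, hne⟩
      rw [mk_append_smul, hxu] at hne ⊢
      rcases List.eq_nil_or_concat w with rfl | ⟨w', y, rfl⟩
      · exact Or.inl (mk_nil_smul v)
      · rw [List.concat_eq_append] at hw hne ⊢
        have hy : y ≠ letterInv x :=
          (isReduced_cons_cons_iff_s10.1 (hw.of_isInfix ⟨w', [], by simp⟩ : IsReduced [y, x])).1
        exact Or.inr (Set.mem_biUnion hy ⟨⟨w', hw.of_isInfix ⟨[], [x], by simp⟩, rfl⟩, hne⟩)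
    · exact hV.side u hu.2 x fun hmem => hx (Finset.mem_erase.2 ⟨hxu, hmem⟩)

lemma card_filter_smul_mem {G : Type*} [Group G] [MulAction G S] [DecidableEq S] (V : Finset S)
    (g : G) : (V.filter fun v => g⁻¹ • v ∈ V).card = (V.filter fun v => g • v ∈ V).card :=
  Finset.card_bij' (fun v _ => g⁻¹ • v) (fun v _ => g • v)
    (fun v hv => by simpa [and_comm] using hv) (fun v hv => by simpa [and_comm] using hv)
    (by simp) (by simp)

/-- Handshake lemma for the induced subgraph of the Schreier graph. -/
lemma sum_degree_eq [DecidableEq S] (V : Finset S) :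
    ∑ v ∈ V, (Finset.univ.filter fun x : Fin k × Bool => mk [x] • v ∈ V).card =
      2 * (inducedEdges (k := k) V).card := by
  have hE : (inducedEdges (k := k) V).card =
      ∑ i : Fin k, (V.filter fun v => FreeGroup.of i • v ∈ V).card := by
    simp_rw [inducedEdges, Finset.card_filter, Finset.sum_product]
    exact Finset.sum_comm
  have hE' : (inducedEdges (k := k) V).card =
      ∑ i : Fin k, (V.filter fun v => (FreeGroup.of i)⁻¹ • v ∈ V).card := by
    rw [hE]
    exact Finset.sum_congr rfl fun i _ => (card_filter_smul_mem V _).symm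
  rw [two_mul]
  nth_rewrite 1 [hE]
  rw [hE', ← Finset.sum_add_distrib]
  simp_rw [Finset.card_filter, ← Finset.sum_add_distrib]
  rw [Finset.sum_comm, Fintype.sum_prod_type]
  refine Finset.sum_congr rfl fun i _ => ?_
  rw [Fintype.sum_bool, ← Finset.sum_add_distrib]
  refine Finset.sum_congr rfl fun v _ => ?_
  rfl

/-- If both sides of `Y` are infinite, some two boundary cones lie on different sides. -/
lemma exists_ne_side_of_isAdapted
    (htrans : ∀ s t : S, ∃ g : FreeGroup (Fin k), g • s = t) {Y : Set S}
    (hY : Y.Infinite) (hY' : Yᶜ.Infinite) {V : Finset S} (hV : IsAdapted k Y V)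
    {col : S → Fin k × Bool → Prop}
    (hcol : ∀ v ∈ V, ∀ x, mk [x] • v ∉ V → ConeSide Y (col v x) v x) :
    ∃ v ∈ V, ∃ x : Fin k × Bool, mk [x] • v ∉ V ∧
      ∃ v' ∈ V, ∃ x' : Fin k × Bool, mk [x'] • v' ∉ V ∧ ¬(col v x ↔ col v' x') := by
  by_contra! hcon
  obtain ⟨c, hc⟩ : ∃ c, ∀ v ∈ V, ∀ x : Fin k × Bool, mk [x] • v ∉ V → ConeSide Y c v x := by
    by_cases hex : ∃ v ∈ V, ∃ x : Fin k × Bool, mk [x] • v ∉ V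
    · obtain ⟨v, hv, x, hx⟩ := hex
      refine ⟨col v x, fun v' hv' x' hx' => ?_⟩
      rw [propext (hcon v hv x hx v' hv' x' hx')]
      exact hcol v' hv' x' hx'
    · exact ⟨True, fun v hv x hx => absurd ⟨v, hv, x, hx⟩ hex⟩
  have hfin : {s | ¬(s ∈ Y ↔ c)}.Finite := by
    have hbig : ((V : Set S) ∪ ⋃ p ∈ {p : S × Fin k × Bool | p.1 ∈ V ∧ mk [p.2] • p.1 ∉ V},
        {s | s ∈ cone p.1 p.2 ∧ ¬(s ∈ Y ↔ c)}).Finite := by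
      refine V.finite_toSet.union (Set.Finite.biUnion ?_ fun p hp => hc _ hp.1 _ hp.2)
      exact (V.finite_toSet.prod (Set.toFinite Set.univ)).subset fun p hp => ⟨hp.1, trivial⟩
    refine hbig.subset fun s hs => ?_
    obtain ⟨v₀, hv₀⟩ := hV.nonempty
    obtain ⟨g, rfl⟩ := htrans v₀ s
    have hcover : ∀ w : List (Fin k × Bool), mk w • v₀ ∈ V ∨
        ∃ w₁ x w₂, w = w₁ ++ [x] ++ w₂ ∧ mk w₂ • v₀ ∈ V ∧ mk [x] • mk w₂ • v₀ ∉ V := by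
      intro w
      induction w with
      | nil => exact Or.inl (by rwa [mk_nil_smul])
      | cons y w ih =>
        rcases ih with ih | ⟨w₁, x, w₂, rfl, h₁, h₂⟩
        · by_cases hy : mk (y :: w) • v₀ ∈ V
          · exact Or.inl hy
          · exact Or.inr ⟨[], y, w, rfl, ih, by rwa [← mk_cons_smul]⟩
        · exact Or.inr ⟨y :: w₁, x, w₂, by simp, h₁, h₂⟩
    rcases hcover g.toWord with h | ⟨w₁, x, w₂, hw, h₁, h₂⟩
    · exact Or.inl (by rwa [FreeGroup.mk_toWord] at h)
    · refine Or.inr (Set.mem_biUnion (x := (mk w₂ • v₀, x)) ⟨h₁, h₂⟩ ⟨⟨w₁, ?_, ?_⟩, hs⟩)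
      · exact (FreeGroup.isReduced_toWord (x := g)).of_isInfix ⟨[], w₂, by rw [hw]; simp⟩
      · rw [← mk_append_smul, ← hw, FreeGroup.mk_toWord]
  by_cases hcT : c
  · exact hY' (hfin.subset fun s hs h => hs (h.2 hcT))
  · exact hY (hfin.subset fun s hs h => hcT (h.1 hs))

/-- An adapted vertex set without vertices of degree at most one spans many edges. -/
lemma card_add_le_of_isAdapted [DecidableEq S] {L : ℕ} (hk : 1 ≤ k) (hL : 2 ≤ L)
    (htrans : ∀ s t : S, ∃ g : FreeGroup (Fin k), g • s = t) {Y : Set S}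
    (hglue : GluesCones k L Y) (hY : Y.Infinite) (hY' : Yᶜ.Infinite) {V : Finset S}
    (hV : IsAdapted k Y V)
    (hdeg : 1 < V.card → ∀ v ∈ V,
      ∃ y y' : Fin k × Bool, y ≠ y' ∧ mk [y] • v ∈ V ∧ mk [y'] • v ∈ V) :
    V.card + (k - 1) * (L - 2) ≤ (inducedEdges (k := k) V).card := by
  classical
  obtain ⟨col, hcol⟩ : ∃ col : S → Fin k × Bool → Prop,
      ∀ v ∈ V, ∀ x, mk [x] • v ∉ V → ConeSide Y (col v x) v x := by
    choose! col hcol using hV.side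
    exact ⟨col, hcol⟩
  let P : ℕ → Prop := fun n => ∃ (v : S) (x x' : Fin k × Bool) (w : List (Fin k × Bool)),
    v ∈ V ∧ mk [x] • v ∉ V ∧ mk w • v ∈ V ∧ mk [x'] • mk w • v ∉ V ∧
      ¬(col v x ↔ col (mk w • v) x') ∧ IsReduced w ∧ w.length = n
  have hP : ∀ {v : S} {x x' : Fin k × Bool} (w : List (Fin k × Bool)), v ∈ V → mk [x] • v ∉ V →
      mk w • v ∈ V → mk [x'] • mk w • v ∉ V → ¬(col v x ↔ col (mk w • v) x') →
      ∃ m, P m ∧ m ≤ w.length := by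
    intro v x x' w h₁ h₂ h₃ h₄ h₅
    refine ⟨(mk w).toWord.length, ⟨v, x, x', (mk w).toWord, h₁, h₂, ?_⟩, FreeGroup.norm_mk_le⟩
    rw [FreeGroup.mk_toWord]
    exact ⟨h₃, h₄, h₅, FreeGroup.isReduced_toWord, rfl⟩
  have hPex : ∃ n, P n := by
    obtain ⟨v, hv, x, hx, v', hv', x', hx', hne⟩ :=
      exists_ne_side_of_isAdapted htrans hY hY' hV hcol
    obtain ⟨g, rfl⟩ := htrans v v'
    rw [← FreeGroup.mk_toWord (x := g)] at hv' hx' hne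
    obtain ⟨m, hm, -⟩ := hP _ hv hx hv' hx' hne
    exact ⟨m, hm⟩
  obtain ⟨v, x, x', w, hv, hx, hw, hx', hne, hred, hlen⟩ := Nat.find_spec hPex
  have hmin : ∀ {u : S} {y y' : Fin k × Bool} (t : List (Fin k × Bool)), u ∈ V → mk [y] • u ∉ V →
      mk t • u ∈ V → mk [y'] • mk t • u ∉ V → ¬(col u y ↔ col (mk t • u) y') →
      w.length ≤ t.length := by
    intro u y y' t h₁ h₂ h₃ h₄ h₅
    obtain ⟨m, hm, hmt⟩ := hP t h₁ h₂ h₃ h₄ h₅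
    rw [hlen]
    exact (Nat.find_min' hPex hm).trans hmt
  have hpath := hV.convex v hv w hred hw
  have hext : IsReduced (x' :: (w ++ [letterInv x])) := by
    have hlast : ∀ b w', w = w' ++ [b] → b ≠ x := by
      rintro b w' rfl rfl
      exact hx (hpath [b] (List.suffix_append _ _))
    have hfirst : ∀ a w', w = a :: w' → x' ≠ letterInv a := by
      rintro a w' rfl rfl
      rw [mk_cons_smul a w', mk_letterInv_smul] at hx'
      exact hx' (hpath w' (List.suffix_cons _ _))
    have hright : IsReduced (w ++ [letterInv x]) := by
      rcases List.eq_nil_or_concat w with hw' | ⟨w', b, hw'⟩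
      · rw [hw']; exact .singleton
      · rw [List.concat_eq_append] at hw'
        rw [hw'] at hred ⊢
        refine hred.append_overlap (L₂ := [b]) (isReduced_cons_cons_iff_s10.2 ⟨?_, .singleton⟩)
          (List.cons_ne_nil _ _)
        rw [letterInv_letterInv]
        exact hlast b w' hw'
    match w, hw, hx', hne, hfirst, hright with
    | [], hw, hx', hne, _, _ =>
      refine isReduced_cons_cons_iff_s10.2 ⟨?_, .singleton⟩
      rw [letterInv_letterInv]
      rintro rfl
      rw [mk_nil_smul] at hne
      exact hne Iff.rfl
    | a :: w', _, _, _, hfirst, hright =>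
      exact isReduced_cons_cons_iff_s10.2 ⟨hfirst a w' rfl, hright⟩
  have hlong : L < w.length + 2 := by
    by_contra! hle
    exact hne (hglue hV.convex hv hw hx' hext hle (hcol _ hv _ hx) (hcol _ hw _ hx'))
  have htwo : 1 < V.card := by
    refine Finset.one_lt_card.2 ⟨v, hv, mk w • v, hw, fun heq => ?_⟩
    rw [← heq] at hx' hne
    have := hmin (u := v) (y := x) (y' := x') [] hv hx (by rwa [mk_nil_smul])
      (by rwa [mk_nil_smul]) (by rwa [mk_nil_smul])
    simp only [List.length_nil] at this
    omega
  have hdrop : ∀ i, mk (w.take i) • mk (w.drop i) • v = mk w • v := fun i => by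
    rw [← mk_append_smul, List.take_append_drop]
  have hdropV : ∀ i, mk (w.drop i) • v ∈ V := fun i => hpath _ (List.drop_suffix _ _)
  let Z : Finset S := (Finset.Icc 1 (w.length - 1)).image fun i => mk (w.drop i) • v
  have hZV : Z ⊆ V := by
    intro s hs
    obtain ⟨i, -, rfl⟩ := Finset.mem_image.1 hs
    exact hdropV i
  have hZcard : Z.card = w.length - 1 := by
    rw [Finset.card_image_of_injOn, Nat.card_Icc, Nat.add_sub_cancel]
    have key : ∀ i j, i < j → j ≤ w.length - 1 → mk (w.drop i) • v ≠ mk (w.drop j) • v := by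
      intro i j hij hj heq
      have hshort : mk (w.take i ++ w.drop j) • v = mk w • v := by
        rw [mk_append_smul, ← heq, hdrop]
      rw [← hshort] at hw hx' hne
      have := hmin _ hv hx hw hx' hne
      simp only [List.length_append, List.length_take, List.length_drop] at this
      omega
    intro i hi j hj hij
    rw [Finset.coe_Icc, Set.mem_Icc] at hi hj
    rcases lt_trichotomy i j with h | h | h
    · exact absurd hij (key i j h hj.2)
    · exact h
    · exact absurd hij.symm (key j i h hi.2)
  have hfull : ∀ s ∈ Z, ∀ y : Fin k × Bool, mk [y] • s ∈ V := by
    intro s hs y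
    obtain ⟨i, hi, rfl⟩ := Finset.mem_image.1 hs
    rw [Finset.mem_Icc] at hi
    by_contra hy
    have hside : ¬(col v x ↔ col (mk (w.drop i) • v) y) ∨
        ¬(col (mk (w.drop i) • v) y ↔ col (mk w • v) x') := by tauto
    rcases hside with hside | hside
    · have := hmin _ hv hx (hdropV i) hy hside
      rw [List.length_drop] at this
      omega
    · rw [← hdrop i] at hw hx' hside
      have := hmin _ (hdropV i) hy hw hx' hside
      rw [List.length_take] at this
      omega
  have hsum : ∑ v ∈ V, (2 + if v ∈ Z then 2 * (k - 1) else 0) ≤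
      ∑ v ∈ V, (Finset.univ.filter fun x : Fin k × Bool => mk [x] • v ∈ V).card := by
    refine Finset.sum_le_sum fun s hs => ?_
    split_ifs with hsZ
    · rw [Finset.filter_true_of_mem fun y _ => hfull s hsZ y, Finset.card_univ]
      simp only [Fintype.card_prod, Fintype.card_fin, Fintype.card_bool]
      omega
    · obtain ⟨y, y', hyy', hy, hy'⟩ := hdeg htwo s hs
      exact Finset.one_lt_card.2 ⟨y, by simpa using hy, y', by simpa using hy', hyy'⟩
  rw [sum_degree_eq, Finset.sum_add_distrib, ← Finset.sum_filter, Finset.filter_mem_eq_inter,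
    Finset.inter_eq_right.2 hZV, Finset.sum_const, Finset.sum_const, hZcard, smul_eq_mul,
    smul_eq_mul] at hsum
  have hmul : (k - 1) * (L - 2) ≤ (w.length - 1) * (k - 1) := by
    rw [mul_comm]
    exact Nat.mul_le_mul_right _ (by omega)
  have hassoc : (w.length - 1) * (2 * (k - 1)) = 2 * ((w.length - 1) * (k - 1)) := by ring
  omega

/-- The rank bound for the point stabilizer of a transitive action whose Schreier graph is
separated by `Y` into two infinite sides. -/
lemma lt_rank_of_gluesCones [DecidableEq S] {L r : ℕ} (hk : 1 ≤ k) (hL : 2 ≤ L)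
    (htrans : ∀ s t : S, ∃ g : FreeGroup (Fin k), g • s = t) (o : S)
    (gens : Fin r → FreeGroup (Fin k))
    (hgens : MulAction.stabilizer (FreeGroup (Fin k)) o = Subgroup.closure (Set.range gens))
    {Y : Set S} (hYfin : ∀ g : FreeGroup (Fin k), {s | ¬(s ∈ Y ↔ g • s ∈ Y)}.Finite)
    (hglue : GluesCones k L Y) (hY : Y.Infinite) (hY' : Yᶜ.Infinite) :
    (k - 1) * (L - 2) < r := by
  classical
  have hex : ∃ n, ∃ V : Finset S, IsAdapted k Y V ∧ V.card = n := by
    obtain ⟨V, hV⟩ := exists_isAdapted htrans o (Set.finite_range gens) hgens hYfin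
    exact ⟨_, V, hV, rfl⟩
  obtain ⟨V, hV, hVcard⟩ := Nat.find_spec hex
  have hdeg : 1 < V.card → ∀ v ∈ V,
      ∃ y y' : Fin k × Bool, y ≠ y' ∧ mk [y] • v ∈ V ∧ mk [y'] • v ∈ V := by
    intro hcard v hv
    by_contra! hcon
    have hne : (V.erase v).Nonempty := by
      rw [← Finset.card_pos, Finset.card_erase_of_mem hv]
      omega
    have herase := isAdapted_erase hL hglue hV hv hne fun y y' hy hy' => by
      by_contra hyy'
      exact hcon y y' hyy' hy hy'
    have := Nat.find_min' hex ⟨_, herase, rfl⟩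
    rw [← hVcard, Finset.card_erase_of_mem hv] at this
    omega
  have h₁ := card_add_le_of_isAdapted hk hL htrans hglue hY hY' hV hdeg
  have h₂ := card_inducedEdges_lt hV.nonempty htrans o gens hgens
  omega

/-- Cones are glued along subwords of `h` if `h` contains all reduced words of length `L` and
lines spelling powers of `h` stay on one side of `Y`. -/
lemma gluesCones_of_forall_subword {L : ℕ} {h : List (Fin k × Bool)}
    (hcyc : FreeGroup.IsCyclicallyReduced h)
    (hall : ∀ u : List (Fin k × Bool), IsReduced u → u.length = L → u <:+: h) {Y : Set S}
    (hline : ∀ s : S, (Function.Injective fun n : ℤ => mk h ^ n • s) →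
      ∃ c : Prop, {n : ℤ | ¬(mk h ^ n • s ∈ Y ↔ c)}.Finite) :
    GluesCones k L Y := by
  intro V hV v x x' w hv hw hx' hred hlen c c' hc hc'
  refine ConeSide.iff_of_subword hcyc hline hV hv hw hx' rfl ?_ hc hc'
  have hpad : ∀ m, IsReduced (List.replicate m x' ++ x' :: (w ++ [letterInv x])) := by
    intro m
    induction m with
    | zero => exact hred
    | succ m ih =>
      cases m with
      | zero => exact isReduced_cons_cons_iff_s10.2 ⟨letterInv_ne x', hred⟩
      | succ m => exact isReduced_cons_cons_iff_s10.2 ⟨letterInv_ne x', ih⟩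
  refine List.IsInfix.trans (List.suffix_append _ _).isInfix
    (hall _ (hpad (L - (w.length + 2))) ?_)
  simp only [List.length_append, List.length_replicate, List.length_cons, List.length_nil]
  omega

end SchreierGraph

/-- Let `k ≥ 2`, `L ≥ 2`, and let `h ∈ F_k` be cyclically reduced and
contain every reduced word of length `L` as a subword. Suppose `F_k ≃ A *_C B` is an
amalgamated free product (expressed by its pushout universal property, with both factors
proper), with `C` free of rank `r`, such that the image of `h` lies in a conjugate of the
canonical image of `A` or of `B`. Then `r > (k−1)(L−2)`. -/
theorem no_small_rank_amalgam_relative_to_h (k L r : ℕ) (hk : 2 ≤ k) (hL : 2 ≤ L)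
    (h : FreeGroup (Fin k)) (hcyc : IsCyclicallyReduced h)
    (hall : ∀ u : List (Fin k × Bool), FreeGroup.reduce u = u → u.length = L →
      u <:+: FreeGroup.toWord h)
    (A B C G : Type) [Group A] [Group B] [Group C] [Group G]
    (iA : C →* A) (iB : C →* B)
    (hiA : Function.Injective iA) (hiB : Function.Injective iB)
    (hrA : iA.range ≠ ⊤) (hrB : iB.range ≠ ⊤)
    (jA : A →* G) (jB : B →* G)
    (hsq : jA.comp iA = jB.comp iB)
    (hpush : ∀ (K : Type) [Group K], ∀ (fA : A →* K) (fB : B →* K),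
      fA.comp iA = fB.comp iB → ∃! f : G →* K, f.comp jA = fA ∧ f.comp jB = fB)
    (hCfree : Nonempty (C ≃* FreeGroup (Fin r)))
    (Φ : FreeGroup (Fin k) ≃* G)
    (hell : ∃ g : G, g * Φ h * g⁻¹ ∈ jA.range ∨ g * Φ h * g⁻¹ ∈ jB.range) :
    (k - 1) * (L - 2) < r := by
  classical
  have hF := (isAmalgam_of_universal hiA hiB hrA hrB hsq hpush).comap Φ
  set C' : Subgroup (FreeGroup (Fin k)) :=
    (jA.comp iA).range.comap Φ.toMonoidHom
  obtain ⟨e⟩ := hCfree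
  let ψ : FreeGroup (Fin r) →* FreeGroup (Fin k) :=
    Φ.symm.toMonoidHom.comp ((jA.comp iA).comp e.symm.toMonoidHom)
  have hψ : ψ.range = C' := by
    ext x
    constructor
    · rintro ⟨y, rfl⟩
      exact ⟨e.symm y, by simp [ψ]⟩
    · rintro ⟨c, hc⟩
      exact ⟨e c, by simpa [ψ, MulEquiv.symm_apply_eq] using hc⟩
  have hgens : MulAction.stabilizer (FreeGroup (Fin k)) ((1 : FreeGroup (Fin k)) : _ ⧸ C') =
      Subgroup.closure (Set.range fun j => ψ (FreeGroup.of j)) := by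
    rw [MulAction.stabilizer_quotient, ← hψ, MonoidHom.range_eq_map,
      ← FreeGroup.closure_range_of, MonoidHom.map_closure, ← Set.range_comp]
    rfl
  have hcyc' : FreeGroup.IsCyclicallyReduced h.toWord := by
    refine FreeGroup.isCyclicallyReduced_iff.2 ⟨FreeGroup.isReduced_toWord, ?_⟩
    exact (List.isChain_append.1 (FreeGroup.isReduced_iff_reduce_eq.2 hcyc)).2.2
  refine lt_rank_of_gluesCones (by omega) hL (fun s t => MulAction.exists_smul_eq _ s t) _ _
    hgens hF.finite_coboundary ?_ hF.infinite_halfTree hF.infinite_compl_halfTree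
  refine gluesCones_of_forall_subword hcyc'
    (fun u hu => hall u (FreeGroup.isReduced_iff_reduce_eq.1 hu)) fun s hinj => ?_
  rw [FreeGroup.mk_toWord] at hinj ⊢
  obtain ⟨g, hg | hg⟩ := hell
  · refine hF.exists_eventual_side (p := Φ.symm g) (i := false) ?_ s hinj
    simpa [Subgroup.mem_comap] using hg
  · refine hF.exists_eventual_side (p := Φ.symm g) (i := true) ?_ s hinj
    simpa [Subgroup.mem_comap] using hg
end
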